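/- arXiv:1702.01564 — 2 statements merged into one kernel-verified Lean document; each statement's English description precedes it below -/
import Mathlib

section
/- Let n ≥ 1 and let F : ℝⁿ → ℝ be a homogeneous polynomial of degree d ≥ 1. Let Γ ⊂ ℝⁿ be a lattice of full rank, i.e. Γ = {Σ_{j=1}^n ℓ_j v_j : ℓ_j ∈ ℤ} for some basis v_1, …, v_n of ℝⁿ, and let Vol(Γ*) = 1/|det(v_1, …, v_n)| denote the covolume of the dual lattice. Define the weighted lattice counting function 𝓜(R) = Σ_{λ∈Γ} F(λ)·1_{|λ|≤R}. Then as R → ∞, 𝓜(R) = (Vol(Γ*) ∫_{|x|≤1} F(x) dx) · R^{d+n} + O(R^{d+n−2/(n+1)}). -/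
open MeasureTheory Filter Asymptotics Finset

theorem ZSpan.measurable_floor {E ι : Type*} [NormedAddCommGroup E] [NormedSpace ℝ E]
    [FiniteDimensional ℝ E] [MeasurableSpace E] [BorelSpace E] [Fintype ι]
    (b : Module.Basis ι ℝ E) : Measurable fun x : E => (ZSpan.floor b x : E) := by
  have h : (fun x : E => (ZSpan.floor b x : E)) =
      fun x => ∑ i, ((⌊b.equivFun x i⌋ : ℤ) : ℝ) • b i := by
    ext x
    simp [ZSpan.floor, Int.cast_smul_eq_zsmul]
  rw [h]
  refine Finset.measurable_fun_sum _ fun i _ => ?_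
  have hb : Measurable fun x : E => b.equivFun x i :=
    (measurable_pi_apply i).comp
      (LinearMap.continuous_of_finiteDimensional b.equivFun.toLinearMap).measurable
  have hc : Measurable fun x : E => ((⌊b.equivFun x i⌋ : ℤ) : ℝ) :=
    (measurable_from_top (f := fun z : ℤ => (z : ℝ))).comp hb.floor
  exact hc.smul_const (b i)

theorem ZSpan.floor_vadd {E ι : Type*} [NormedAddCommGroup E] [NormedSpace ℝ E] [Fintype ι]
    (b : Module.Basis ι ℝ E) (g : Submodule.span ℤ (Set.range b)) {x : E}
    (hx : x ∈ ZSpan.fundamentalDomain b) : (ZSpan.floor b ((g : E) + x) : E) = g := by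
  have h := ZSpan.fract_zSpan_add b x g.2
  rw [ZSpan.fract_eq_self.2 hx, ZSpan.fract_apply] at h
  have h2 : (ZSpan.floor b ((g : E) + x) : E) = (g : E) + x - x := by
    nth_rewrite 3 [← h]
    abel
  simpa using h2

theorem ZSpan.integral_comp_floor {E ι : Type*} [NormedAddCommGroup E] [NormedSpace ℝ E]
    [FiniteDimensional ℝ E] [MeasurableSpace E] [BorelSpace E] [Fintype ι]
    (μ : Measure E) [μ.IsAddHaarMeasure] (b : Module.Basis ι ℝ E) (f : E → ℝ)
    (hf : Integrable (fun x => f (ZSpan.floor b x)) μ) :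
    ∫ x, f (ZSpan.floor b x) ∂μ =
      μ.real (ZSpan.fundamentalDomain b) * ∑' l : ι → ℤ, f (∑ j, (l j : ℝ) • b j) := by
  have : VAddInvariantMeasure (Submodule.span ℤ (Set.range b)) E μ :=
    inferInstanceAs <| VAddInvariantMeasure (Submodule.span ℤ (Set.range b)).toAddSubgroup E μ
  have hterm (g : Submodule.span ℤ (Set.range b)) :
      ∫ x in ZSpan.fundamentalDomain b, f (ZSpan.floor b (g +ᵥ x)) ∂μ =
        μ.real (ZSpan.fundamentalDomain b) * f g := by
    rw [setIntegral_congr_fun (g := fun _ => f g) (ZSpan.fundamentalDomain_measurableSet b)]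
    · simp
    · intro x hx
      simp only [Submodule.vadd_def, vadd_eq_add]
      rw [ZSpan.floor_vadd b g hx]
  rw [(ZSpan.isAddFundamentalDomain b μ).integral_eq_tsum'' _ hf]
  simp_rw [hterm, tsum_mul_left]
  congr 1
  rw [← (b.restrictScalars ℤ).equivFun.symm.toEquiv.tsum_eq]
  refine tsum_congr fun l => ?_
  simp [Module.Basis.equivFun_symm_apply, Int.cast_smul_eq_zsmul]

theorem ZSpan.norm_sub_floor_le {E ι : Type*} [NormedAddCommGroup E] [NormedSpace ℝ E] [Fintype ι]
    (b : Module.Basis ι ℝ E) (x : E) : ‖x - ZSpan.floor b x‖ ≤ ∑ i, ‖b i‖ :=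
  ZSpan.norm_fract_le b x

theorem add_pow_sub_sub_pow_le {c r : ℝ} (m : ℕ) (hc : 0 ≤ c) (hcr : c ≤ r) :
    (r + c) ^ (m + 1) - (r - c) ^ (m + 1) ≤ 2 * c * (m + 1) * 2 ^ m * r ^ m := by
  have h := (le_abs_self _).trans (abs_pow_sub_pow_le (a := r + c) (b := r - c) (n := m + 1))
  have h1 : |r + c| = r + c := abs_of_nonneg (by linarith)
  have h2 : |r - c| = r - c := abs_of_nonneg (by linarith)
  have h3 : |r + c - (r - c)| = 2 * c := by rw [abs_of_nonneg] <;> linarith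
  rw [h1, h2, h3, max_eq_left (by linarith)] at h
  refine h.trans ?_
  have h4 : (r + c) ^ m ≤ (2 * r) ^ m := by gcongr <;> linarith
  rw [mul_pow] at h4
  calc _ = 2 * c * (m + 1) * (r + c) ^ m := by push_cast; simp
    _ ≤ 2 * c * (m + 1) * (2 ^ m * r ^ m) := by gcongr
    _ = _ := by ring

/-- A homogeneous function that is Lipschitz on the unit ball, cut off to the ball of radius `r`,
changes by at most this much when its argument is moved by at most `c`. -/
theorem abs_indicator_sub_indicator_le {E : Type*} [NormedAddCommGroup E] [NormedSpace ℝ E]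
    {F : E → ℝ} {d : ℕ} {L : NNReal} {M c r : ℝ}
    (hhom : ∀ t : ℝ, 0 < t → ∀ x, F (t • x) = t ^ d * F x)
    (hL : LipschitzOnWith L F (Metric.closedBall 0 1))
    (hM : ∀ x ∈ Metric.closedBall (0 : E) 1, |F x| ≤ M) (hr : 0 < r) {x y : E}
    (hxy : ‖x - y‖ ≤ c) :
    |(Metric.closedBall 0 r).indicator F y - (Metric.closedBall 0 r).indicator F x| ≤
      r ^ d * (L * c / r * (Metric.closedBall (0 : E) (r + c)).indicator 1 x +
        M * ((Metric.closedBall (0 : E) (r + c)).indicator 1 x -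
          (Metric.closedBall (0 : E) (r - c)).indicator 1 x)) := by
  have hc : 0 ≤ c := (norm_nonneg _).trans hxy
  have hM0 : 0 ≤ M := (abs_nonneg _).trans (hM 0 (by simp))
  have hmem {z : E} (hz : ‖z‖ ≤ r) : r⁻¹ • z ∈ Metric.closedBall (0 : E) 1 := by
    rw [mem_closedBall_zero_iff, norm_smul, norm_inv, Real.norm_of_nonneg hr.le]
    rwa [inv_mul_le_iff₀ hr, mul_one]
  have hF (z : E) : F z = r ^ d * F (r⁻¹ • z) := by
    rw [← hhom r hr, smul_inv_smul₀ hr.ne']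
  have hbd {z : E} (hz : ‖z‖ ≤ r) : |F z| ≤ r ^ d * M := by
    rw [hF z, abs_mul, abs_of_pos (pow_pos hr d)]
    gcongr
    exact hM _ (hmem hz)
  have hxn : ‖x‖ ≤ ‖y‖ + c := by linarith [norm_sub_norm_le x y]
  have hyn : ‖y‖ ≤ ‖x‖ + c := by linarith [norm_sub_norm_le y x, norm_sub_rev x y]
  have hLc : 0 ≤ L * c / r := by positivity
  have hrd : 0 < r ^ d := pow_pos hr d
  simp only [Set.indicator, mem_closedBall_zero_iff, Pi.one_apply]
  by_cases hx : ‖x‖ ≤ r <;> by_cases hy : ‖y‖ ≤ r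
  · have h1 : |F y - F x| ≤ r ^ d * (L * c / r) := by
      rw [hF y, hF x, ← mul_sub, abs_mul, abs_of_pos hrd]
      gcongr
      have := hL.dist_le_mul _ (hmem hy) _ (hmem hx)
      rw [Real.dist_eq] at this
      refine this.trans ?_
      rw [dist_eq_norm, ← smul_sub, norm_smul, norm_inv, Real.norm_of_nonneg hr.le, mul_div_assoc,
        div_eq_inv_mul, norm_sub_rev]
      gcongr
    rw [if_pos hx, if_pos hy, if_pos (by linarith)]
    refine h1.trans ?_
    gcongr
    split_ifs <;> nlinarith
  · rw [if_pos hx, if_neg hy, if_pos (by linarith), if_neg (by linarith), zero_sub, abs_neg]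
    refine (hbd hx).trans ?_
    gcongr
    linarith
  · rw [if_neg hx, if_pos hy, if_pos (by linarith), if_neg (by linarith), sub_zero]
    refine (hbd hy).trans ?_
    gcongr
    linarith
  · rw [if_neg hx, if_neg hy, if_neg (c := ‖x‖ ≤ r - c) (by linarith)]
    simp only [sub_zero, abs_zero]
    split_ifs <;> positivity

theorem integral_indicator_closedBall_of_homogeneous {E : Type*} [NormedAddCommGroup E]
    [NormedSpace ℝ E] [FiniteDimensional ℝ E] [MeasurableSpace E] [BorelSpace E]
    (μ : Measure E) [μ.IsAddHaarMeasure] {F : E → ℝ} {d : ℕ}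
    (hhom : ∀ t : ℝ, 0 < t → ∀ x, F (t • x) = t ^ d * F x) {r : ℝ} (hr : 0 < r) :
    ∫ x, (Metric.closedBall 0 r).indicator F x ∂μ =
      (∫ x in Metric.closedBall 0 1, F x ∂μ) * r ^ (d + Module.finrank ℝ E) := by
  have h := Measure.integral_comp_smul_of_nonneg μ ((Metric.closedBall 0 r).indicator F) r
    (hR := hr.le)
  have h2 (x : E) : (Metric.closedBall 0 r).indicator F (r • x) =
      r ^ d * (Metric.closedBall 0 1).indicator F x := by
    have : ‖r • x‖ ≤ r ↔ ‖x‖ ≤ 1 := by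
      rw [norm_smul, Real.norm_of_nonneg hr.le, mul_le_iff_le_one_right hr]
    simp only [Set.indicator, mem_closedBall_zero_iff, this, hhom r hr x, mul_ite, mul_zero]
  simp_rw [h2] at h
  rw [integral_const_mul, integral_indicator Metric.isClosed_closedBall.measurableSet,
    smul_eq_mul, eq_inv_mul_iff_mul_eq₀ (pow_pos hr _).ne'] at h
  rw [← h]
  ring

theorem abs_integral_indicator_floor_sub_le {E ι : Type*} [NormedAddCommGroup E]
    [NormedSpace ℝ E] [FiniteDimensional ℝ E] [MeasurableSpace E] [BorelSpace E] [Fintype ι]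
    (μ : Measure E) [μ.IsAddHaarMeasure] (b : Module.Basis ι ℝ E) {F : E → ℝ} {d m : ℕ}
    (hm : Module.finrank ℝ E = m + 1) (hcont : Continuous F)
    {L : NNReal} {M c r : ℝ} (hhom : ∀ t : ℝ, 0 < t → ∀ x, F (t • x) = t ^ d * F x)
    (hL : LipschitzOnWith L F (Metric.closedBall 0 1))
    (hM : ∀ x ∈ Metric.closedBall (0 : E) 1, |F x| ≤ M) (hr : 0 < r)
    (hc : ∑ i, ‖b i‖ ≤ c) (hcr : c ≤ r) :
    Integrable (fun x => (Metric.closedBall 0 r).indicator F (ZSpan.floor b x)) μ ∧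
    |∫ x, (Metric.closedBall 0 r).indicator F (ZSpan.floor b x) ∂μ -
        ∫ x, (Metric.closedBall 0 r).indicator F x ∂μ| ≤
      (L * c * 2 ^ (m + 1) + M * (2 * c * (m + 1) * 2 ^ m)) *
        μ.real (Metric.ball 0 1) * r ^ (d + m) := by
  have hc0 : 0 ≤ c := (Finset.sum_nonneg fun i _ => norm_nonneg (b i)).trans hc
  have hM0 : 0 ≤ M := (abs_nonneg _).trans (hM 0 (by simp))
  have hball (s : ℝ) : Integrable ((Metric.closedBall (0 : E) s).indicator (1 : E → ℝ)) μ :=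
    (integrable_indicator_iff Metric.isClosed_closedBall.measurableSet).2
      (integrableOn_const (isCompact_closedBall 0 s).measure_lt_top.ne)
  have hg : Integrable ((Metric.closedBall 0 r).indicator F) μ :=
    (integrable_indicator_iff Metric.isClosed_closedBall.measurableSet).2
      (hcont.continuousOn.integrableOn_compact (isCompact_closedBall 0 r))
  have hsub : Integrable (fun x : E =>
      M * ((Metric.closedBall (0 : E) (r + c)).indicator (1 : E → ℝ) x -
        (Metric.closedBall (0 : E) (r - c)).indicator (1 : E → ℝ) x)) μ :=
    ((hball _).sub (hball _)).const_mul _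
  have hint : Integrable (fun x : E =>
      r ^ d * (L * c / r * (Metric.closedBall (0 : E) (r + c)).indicator (1 : E → ℝ) x +
        M * ((Metric.closedBall (0 : E) (r + c)).indicator (1 : E → ℝ) x -
          (Metric.closedBall (0 : E) (r - c)).indicator (1 : E → ℝ) x))) μ :=
    (((hball _).const_mul _).add hsub).const_mul _
  have hpt (x : E) := abs_indicator_sub_indicator_le hhom hL hM hr
    ((ZSpan.norm_sub_floor_le b x).trans hc)
  have hmeas : Measurable fun x : E => (Metric.closedBall 0 r).indicator F (ZSpan.floor b x) :=
    (hcont.measurable.indicator Metric.isClosed_closedBall.measurableSet).comp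
      (ZSpan.measurable_floor b)
  have hdiff : Integrable (fun x => (Metric.closedBall 0 r).indicator F (ZSpan.floor b x) -
      (Metric.closedBall 0 r).indicator F x) μ :=
    hint.mono' (hmeas.aestronglyMeasurable.sub hg.aestronglyMeasurable) (ae_of_all _ hpt)
  have hh : Integrable (fun x => (Metric.closedBall 0 r).indicator F (ZSpan.floor b x)) μ := by
    exact (hdiff.add hg).congr (ae_of_all _ fun x => by simp)
  refine ⟨hh, ?_⟩
  rw [← integral_sub hh hg, ← Real.norm_eq_abs]
  refine (norm_integral_le_of_norm_le hint (ae_of_all _ hpt)).trans ?_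
  have hval {s : ℝ} (hs : 0 ≤ s) : ∫ x, (Metric.closedBall (0 : E) s).indicator (1 : E → ℝ) x ∂μ =
      s ^ (m + 1) * μ.real (Metric.ball 0 1) := by
    rw [integral_indicator_one Metric.isClosed_closedBall.measurableSet,
      Measure.addHaar_real_closedBall μ 0 hs, hm]
  rw [integral_const_mul, integral_add ((hball _).const_mul _) hsub,
    integral_const_mul, integral_const_mul,
    integral_sub (hball _) (hball _), hval (by linarith), hval (by linarith), ← sub_mul]
  have h1 := add_pow_sub_sub_pow_le m hc0 hcr
  have h2 : (r + c) ^ (m + 1) ≤ 2 ^ (m + 1) * r ^ (m + 1) := by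
    rw [← mul_pow]
    gcongr
    linarith
  calc _ ≤ r ^ d * (L * c / r * (2 ^ (m + 1) * r ^ (m + 1) * μ.real (Metric.ball 0 1)) +
        M * (2 * c * (m + 1) * 2 ^ m * r ^ m * μ.real (Metric.ball 0 1))) := by gcongr
    _ = _ := by
      field_simp
      ring

theorem MvPolynomial.contDiff_eval_euclideanSpace {ι : Type*} [Fintype ι] (P : MvPolynomial ι ℝ) :
    ContDiff ℝ 1 fun x : EuclideanSpace ℝ ι => MvPolynomial.eval (fun i => x i) P := by
  induction P using MvPolynomial.induction_on with
  | C a => simpa using contDiff_const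
  | add p q hp hq => simpa using hp.add hq
  | mul_X p i hp =>
    simp only [map_mul, MvPolynomial.eval_X]
    exact hp.mul (by fun_prop)

theorem MvPolynomial.IsHomogeneous.eval_mul_left {ι : Type*} {P : MvPolynomial ι ℝ} {d : ℕ}
    (hP : P.IsHomogeneous d) (t : ℝ) (x : ι → ℝ) :
    MvPolynomial.eval (fun i => t * x i) P = t ^ d * MvPolynomial.eval x P := by
  rw [MvPolynomial.eval_eq, MvPolynomial.eval_eq, Finset.mul_sum]
  refine Finset.sum_congr rfl fun s hs => ?_
  have hd : ∑ i ∈ s.support, s i = d := by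
    simpa [Finsupp.weight_apply, Finsupp.sum] using hP (MvPolynomial.mem_support_iff.1 hs)
  simp_rw [mul_pow, Finset.prod_mul_distrib, Finset.prod_pow_eq_pow_sum, hd]
  ring

theorem EuclideanSpace.measureReal_fundamentalDomain {ι : Type*} [Fintype ι] [DecidableEq ι]
    (b : Module.Basis ι ℝ (EuclideanSpace ℝ ι)) :
    volume.real (ZSpan.fundamentalDomain b) = |(Matrix.of fun i j => b j i).det| := by
  rw [ZSpan.measureReal_fundamentalDomain b volume (EuclideanSpace.basisFun ι ℝ).toBasis,
    measureReal_congr (ZSpan.fundamentalDomain_ae_parallelepiped _ _), measureReal_def]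
  have h := (EuclideanSpace.basisFun ι ℝ).volume_parallelepiped
  rw [OrthonormalBasis.coe_toBasis, h, ENNReal.toReal_one, mul_one, Module.Basis.det_apply]
  congr 2

/-- **Weighted lattice point counting (Theorem 3.1).**
Let `F` be a homogeneous polynomial of degree `d ≥ 1` on `ℝⁿ` and `Γ ⊂ ℝⁿ` the lattice of
full rank generated by a basis `v₁, …, vₙ` of `ℝⁿ`.  Then the weighted counting function
`𝓜(R) = Σ_{λ ∈ Γ} F(λ) 1_{|λ| ≤ R}` satisfies
`𝓜(R) = (Vol(Γ*) ∫_{|x|≤1} F) R^{d+n} + O(R^{d+n-2/(n+1)})` as `R → ∞`,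
where `Vol(Γ*) = 1/|det(v₁,…,vₙ)|`. -/
theorem stmt0 (n d : ℕ) (hn : 1 ≤ n) (hd : 1 ≤ d)
    (P : MvPolynomial (Fin n) ℝ) (hP : P.IsHomogeneous d)
    (v : Fin n → EuclideanSpace ℝ (Fin n))
    (hv : LinearIndependent ℝ v) (hspan : Submodule.span ℝ (Set.range v) = ⊤)
    (𝓜 : ℝ → ℝ)
    (h𝓜 : ∀ R : ℝ, 𝓜 R = ∑' ℓ : Fin n → ℤ,
      if ‖∑ j, (ℓ j : ℝ) • v j‖ ≤ R then
        MvPolynomial.eval (fun i => (∑ j, (ℓ j : ℝ) • v j) i) P else 0) :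
    (fun R : ℝ => 𝓜 R -
        ((1 / |(Matrix.of fun i j => v j i).det|) *
            ∫ x in Metric.closedBall (0 : EuclideanSpace ℝ (Fin n)) 1,
              MvPolynomial.eval (fun i => x i) P) * R ^ (d + n))
      =O[atTop] (fun R : ℝ => R ^ ((d : ℝ) + n - 2 / (n + 1))) := by
  obtain ⟨m, rfl⟩ : ∃ m, n = m + 1 := ⟨n - 1, by omega⟩
  set F : EuclideanSpace ℝ (Fin (m + 1)) → ℝ := fun x => MvPolynomial.eval (fun i => x i) P with hF
  have hhom (t : ℝ) (_ : 0 < t) (x : EuclideanSpace ℝ (Fin (m + 1))) :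
      F (t • x) = t ^ d * F x := by
    simpa [hF] using hP.eval_mul_left t fun i => x i
  have hdiff : ContDiff ℝ 1 F := P.contDiff_eval_euclideanSpace
  obtain ⟨L, hL⟩ := hdiff.contDiffOn.exists_lipschitzOnWith one_ne_zero
    (convex_closedBall 0 1) (isCompact_closedBall 0 1)
  obtain ⟨M, hM⟩ := (isCompact_closedBall (0 : EuclideanSpace ℝ (Fin (m + 1)))
    1).exists_bound_of_continuousOn hdiff.continuous.continuousOn
  let b : Module.Basis (Fin (m + 1)) ℝ (EuclideanSpace ℝ (Fin (m + 1))) :=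
    Module.Basis.mk hv hspan.ge
  have hb : ⇑b = v := Module.Basis.coe_mk hv hspan.ge
  set c : ℝ := ∑ i, ‖v i‖
  set D : ℝ := |(Matrix.of fun i j => v j i).det| with hD
  have hvol : volume.real (ZSpan.fundamentalDomain b) = D := by
    rw [EuclideanSpace.measureReal_fundamentalDomain b, hb]
  have hD0 : D ≠ 0 := by
    rw [← hvol, measureReal_def]
    exact ENNReal.toReal_ne_zero.2 ⟨ZSpan.measure_fundamentalDomain_ne_zero b,
      (ZSpan.fundamentalDomain_isBounded b).measure_lt_top.ne⟩
  have hDpos : 0 < D := lt_of_le_of_ne (abs_nonneg _) hD0.symm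
  have hfin : Module.finrank ℝ (EuclideanSpace ℝ (Fin (m + 1))) = m + 1 := by simp
  refine IsBigO.of_bound (D⁻¹ * ((L * c * 2 ^ (m + 1) + M * (2 * c * (m + 1) * 2 ^ m)) *
    volume.real (Metric.ball (0 : EuclideanSpace ℝ (Fin (m + 1))) 1))) ?_
  filter_upwards [eventually_ge_atTop 1, eventually_ge_atTop c] with r hr1 hrc
  have hr : 0 < r := by linarith
  obtain ⟨hint, hle⟩ := abs_integral_indicator_floor_sub_le volume b hfin hdiff.continuous hhom hL
    hM hr (by rw [hb]) hrc
  rw [ZSpan.integral_comp_floor volume b _ hint, hvol,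
    integral_indicator_closedBall_of_homogeneous volume hhom hr, hfin, hb] at hle
  have hsum : 𝓜 r = ∑' l : Fin (m + 1) → ℤ,
      (Metric.closedBall 0 r).indicator F (∑ j, (l j : ℝ) • v j) := by
    rw [h𝓜]
    simp only [Set.indicator, mem_closedBall_zero_iff, hF]
  rw [← hsum] at hle
  have hpow : r ^ (d + m) ≤ r ^ ((d : ℝ) + (m + 1 : ℕ) - 2 / ((m + 1 : ℕ) + 1)) := by
    rw [← Real.rpow_natCast]
    refine Real.rpow_le_rpow_of_exponent_le hr1 ?_
    have : (2 : ℝ) / ((m + 1 : ℕ) + 1) ≤ 1 := by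
      rw [div_le_one (by positivity)]
      push_cast
      linarith [(Nat.cast_nonneg m : (0 : ℝ) ≤ m)]
    push_cast at this ⊢
    linarith
  have hM0 : 0 ≤ M := (norm_nonneg _).trans (hM 0 (by simp))
  have hc0 : 0 ≤ c := Finset.sum_nonneg fun i _ => norm_nonneg (v i)
  have heq : 𝓜 r - 1 / D * (∫ x in Metric.closedBall 0 1, F x) * r ^ (d + (m + 1)) =
      D⁻¹ * (D * 𝓜 r - (∫ x in Metric.closedBall 0 1, F x) * r ^ (d + (m + 1))) := by
    field_simp
  rw [heq, norm_mul, norm_inv, Real.norm_of_nonneg hDpos.le, Real.norm_eq_abs,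
    Real.norm_of_nonneg (Real.rpow_nonneg hr.le _), mul_assoc]
  gcongr
  exact hle.trans (by gcongr)
end

section
/- Let n ≥ 2, let F : ℝⁿ → ℝ be a homogeneous polynomial of degree d ≥ 1, let Γ ⊂ ℝⁿ be a lattice of full rank with dual covolume Vol(Γ*) = 1/|det(v_1, …, v_n)|, and let ρ : ℝⁿ → ℝ be a Schwartz function with ∫_{ℝⁿ} ρ = 1. For ε > 0 set ρ_ε(x) = ε^{−n} ρ(x/ε), write F_R = F·1_{|x|≤R}, and define the mollified counting function 𝓜_ε(R) = Σ_{λ∈Γ} (F_R ⋆ ρ_ε)(λ), where ⋆ denotes convolution on ℝⁿ. Then there exist constants C > 0 and R₀ > 0 such that for all R ≥ R₀ and all ε ∈ (0,1], |𝓜_ε(R) − Vol(Γ*) R^{d+n} ∫_{|x|≤1} F(x) dx| ≤ C R^{d+(n−1)/2} ε^{−(n−1)/2}. -/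
open MeasureTheory Filter Asymptotics Finset

lemma exists_bound_eval_sin (q : Polynomial ℝ) :
    ∃ M, 0 ≤ M ∧ ∀ θ : ℝ, |q.eval (Real.sin θ)| ≤ M := by
  obtain ⟨M, hM⟩ := (isCompact_Icc (a := (-1 : ℝ)) (b := 1)).exists_bound_of_continuousOn
    q.continuous.continuousOn
  exact ⟨M, (norm_nonneg _).trans (hM 0 (by simp)), fun θ => hM _ (Real.sin_mem_Icc θ)⟩

lemma norm_integral_mul_cos_mul_exp_sin_le {a b τ : ℝ} (hτ : 0 < τ) {u u' : ℝ → ℝ}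
    (hu : ∀ x ∈ Set.uIcc a b, HasDerivAt u (u' x) x) (hu' : ContinuousOn u' (Set.uIcc a b)) :
    ‖∫ θ in a..b, ((u θ * Real.cos θ : ℝ) : ℂ) * Complex.exp (Complex.I * τ * Real.sin θ)‖ ≤
      τ⁻¹ * (|u a| + |u b| +
        ‖∫ θ in a..b, ((u' θ : ℝ) : ℂ) * Complex.exp (Complex.I * τ * Real.sin θ)‖) := by
  have hτ' : (Complex.I * τ : ℂ) ≠ 0 := by simp [hτ.ne']
  have hnorm : ∀ x : ℝ, ‖Complex.exp (Complex.I * τ * Real.sin x)‖ = 1 := fun x => by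
    rw [show Complex.I * τ * Real.sin x = ((τ * Real.sin x : ℝ) : ℂ) * Complex.I by push_cast; ring,
      Complex.norm_exp_ofReal_mul_I]
  have hv : ∀ x : ℝ, HasDerivAt
      (fun θ : ℝ => Complex.exp (Complex.I * τ * Real.sin θ))
      (Complex.exp (Complex.I * τ * Real.sin x) * (Complex.I * τ * Real.cos x)) x := fun x =>
    (((Real.hasDerivAt_sin x).ofReal_comp).const_mul _).cexp
  have h := intervalIntegral.integral_mul_deriv_eq_deriv_mul
    (u := fun θ => ((u θ : ℝ) : ℂ)) (u' := fun θ => ((u' θ : ℝ) : ℂ))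
    (fun x hx => (hu x hx).ofReal_comp) (fun x _ => hv x)
    (ContinuousOn.intervalIntegrable (by fun_prop))
    (Continuous.intervalIntegrable (by fun_prop) _ _)
  have h2 : (∫ θ in a..b, ((u θ : ℝ) : ℂ) *
      (Complex.exp (Complex.I * τ * Real.sin θ) * (Complex.I * τ * Real.cos θ))) =
      (Complex.I * τ) * ∫ θ in a..b, ((u θ * Real.cos θ : ℝ) : ℂ) *
        Complex.exp (Complex.I * τ * Real.sin θ) := by
    rw [← intervalIntegral.integral_const_mul]
    congr 1; ext θ; push_cast; ring
  rw [h2] at h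
  have h3 := congrArg norm h
  rw [norm_mul, norm_mul, Complex.norm_I, one_mul, Complex.norm_real, Real.norm_of_nonneg hτ.le]
    at h3
  rw [inv_mul_eq_div, le_div_iff₀ hτ, mul_comm, h3]
  refine (norm_sub_le _ _).trans ?_
  gcongr
  refine (norm_sub_le _ _).trans ?_
  rw [norm_mul, norm_mul, hnorm, hnorm]
  simp [add_comm]

lemma norm_integral_mul_exp_sin_le {a b τ K : ℝ} (hab : a ≤ b) {u : ℝ → ℝ}
    (hu : ∀ x ∈ Set.Ioc a b, |u x| ≤ K) :
    ‖∫ θ in a..b, ((u θ : ℝ) : ℂ) * Complex.exp (Complex.I * τ * Real.sin θ)‖ ≤ K * (b - a) := by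
  have := intervalIntegral.norm_integral_le_of_norm_le_const (a := a) (b := b) (C := K)
    (f := fun θ => ((u θ : ℝ) : ℂ) * Complex.exp (Complex.I * τ * Real.sin θ)) ?_
  · rwa [abs_of_nonneg (sub_nonneg.2 hab)] at this
  · intro x hx
    rw [Set.uIoc_of_le hab] at hx
    rw [norm_mul, show Complex.I * τ * Real.sin x = ((τ * Real.sin x : ℝ) : ℂ) * Complex.I by
      push_cast; ring, Complex.norm_exp_ofReal_mul_I]
    simpa using hu x hx

lemma exists_norm_integral_eval_sin_mul_exp_sin_le (q : Polynomial ℝ) :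
    ∃ C, 0 ≤ C ∧ ∀ τ : ℝ, 1 ≤ τ →
      ‖∫ θ in (-(Real.pi / 2))..(Real.pi / 2),
        ((q.eval (Real.sin θ) : ℝ) : ℂ) * Complex.exp (Complex.I * τ * Real.sin θ)‖
        ≤ C * τ ^ (-(1 / 2) : ℝ) := by
  obtain ⟨M, hM0, hM⟩ := exists_bound_eval_sin q
  obtain ⟨M', hM'0, hM'⟩ := exists_bound_eval_sin q.derivative
  have hpi := Real.pi_pos
  refine ⟨2 * M + (2 * M * Real.pi + M' * Real.pi), by positivity, fun τ hτ => ?_⟩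
  have hτ0 : 0 < τ := by linarith
  set δ : ℝ := τ ^ (-(1 / 2) : ℝ) with hδ
  have hδ0 : 0 < δ := Real.rpow_pos_of_pos hτ0 _
  have hδ1 : δ ≤ 1 := Real.rpow_le_one_of_one_le_of_nonpos hτ (by norm_num)
  have hδτ : τ⁻¹ = δ * δ := by
    rw [hδ, ← Real.rpow_add hτ0, ← Real.rpow_neg_one]; norm_num
  have hπ2 : 1 < Real.pi / 2 := by linarith [Real.pi_gt_three]
  set f : ℝ → ℂ := fun θ => ((q.eval (Real.sin θ) : ℝ) : ℂ) *
    Complex.exp (Complex.I * τ * Real.sin θ) with hf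
  have hfc : Continuous f := by
    have := q.continuous
    fun_prop
  have hfi : ∀ a b, IntervalIntegrable f volume a b := fun a b => hfc.intervalIntegrable a b
  set c : ℝ := Real.pi / 2 - δ with hc
  have hc0 : 0 ≤ c := by linarith
  have hsplit : ∫ θ in (-(Real.pi / 2))..(Real.pi / 2), f θ =
      (∫ θ in (-(Real.pi / 2))..(-c), f θ) + (∫ θ in (-c)..c, f θ) +
        ∫ θ in c..(Real.pi / 2), f θ := by
    rw [intervalIntegral.integral_add_adjacent_intervals (hfi _ _) (hfi _ _),
      intervalIntegral.integral_add_adjacent_intervals (hfi _ _) (hfi _ _)]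
  have h1 : ‖∫ θ in (-(Real.pi / 2))..(-c), f θ‖ ≤ M * δ := by
    convert norm_integral_mul_exp_sin_le (a := -(Real.pi / 2)) (b := -c) (τ := τ) (K := M)
      (by linarith) (fun x _ => hM x) using 2
    rw [hc]; ring
  have h3 : ‖∫ θ in c..(Real.pi / 2), f θ‖ ≤ M * δ := by
    convert norm_integral_mul_exp_sin_le (a := c) (b := Real.pi / 2) (τ := τ) (K := M)
      (by linarith) (fun x _ => hM x) using 2
    rw [hc]; ring
  have hcosc : Real.cos c = Real.sin δ := by rw [hc, Real.cos_pi_div_two_sub]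
  have hsin : 2 / Real.pi * δ ≤ Real.sin δ := Real.mul_le_sin hδ0.le (by linarith)
  have hsin0 : 0 < Real.sin δ := lt_of_lt_of_le (by positivity) hsin
  have hsininv : (Real.sin δ)⁻¹ ≤ Real.pi / 2 * δ⁻¹ := by
    rw [show Real.pi / 2 * δ⁻¹ = (2 / Real.pi * δ)⁻¹ by field_simp]
    gcongr
  have hcos : ∀ x ∈ Set.uIcc (-c) c, 0 < Real.cos x := fun x hx => by
    rw [Set.uIcc_of_le (by linarith)] at hx
    exact Real.cos_pos_of_mem_Ioo ⟨by linarith [hx.1], by linarith [hx.2]⟩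
  have hcos' : ∀ x ∈ Set.uIcc (-c) c, Real.cos x ≠ 0 := fun x hx => (hcos x hx).ne'
  have h2 : ‖∫ θ in (-c)..c, f θ‖ ≤ (2 * M * Real.pi + M' * Real.pi) * δ := by
    have hu : ∀ x ∈ Set.uIcc (-c) c, HasDerivAt (fun θ => q.eval (Real.sin θ) / Real.cos θ)
        (q.derivative.eval (Real.sin x) +
          q.eval (Real.sin x) * Real.sin x / Real.cos x ^ 2) x := fun x hx => by
      have h0 := hcos' x hx
      have := ((q.hasDerivAt (Real.sin x)).comp x (Real.hasDerivAt_sin x)).div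
        (Real.hasDerivAt_cos x) h0
      refine this.congr_deriv ?_
      simp only [Function.comp]
      field_simp
      ring
    have hcont : ContinuousOn (fun x => q.derivative.eval (Real.sin x) +
          q.eval (Real.sin x) * Real.sin x / Real.cos x ^ 2) (Set.uIcc (-c) c) := by
      have h1 := q.continuous
      have h2 := q.derivative.continuous
      refine ContinuousOn.add (by fun_prop) (ContinuousOn.div (by fun_prop) (by fun_prop) ?_)
      exact fun x hx => pow_ne_zero _ (hcos' x hx)
    have hmain := norm_integral_mul_cos_mul_exp_sin_le hτ0 hu hcont
    have hlhs : (∫ θ in (-c)..c, f θ) = ∫ θ in (-c)..c,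
        ((q.eval (Real.sin θ) / Real.cos θ * Real.cos θ : ℝ) : ℂ) *
          Complex.exp (Complex.I * τ * Real.sin θ) := by
      refine intervalIntegral.integral_congr fun x hx => ?_
      simp only [hf]
      rw [div_mul_cancel₀ _ (hcos' x hx)]
    rw [hlhs]
    refine hmain.trans ?_
    have hint : ‖∫ θ in (-c)..c, ((q.derivative.eval (Real.sin θ) +
          q.eval (Real.sin θ) * Real.sin θ / Real.cos θ ^ 2 : ℝ) : ℂ) *
          Complex.exp (Complex.I * τ * Real.sin θ)‖ ≤ M' * Real.pi + 2 * M * (Real.sin δ)⁻¹ := by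
      have hd : ∀ x ∈ Set.uIcc (-c) c, HasDerivAt (fun θ => M' * θ + M * Real.tan θ)
          (M' + M * (1 / Real.cos x ^ 2)) x := fun x hx => by
        refine (((hasDerivAt_id x).const_mul M').add
          ((Real.hasDerivAt_tan (hcos' x hx)).const_mul M)).congr_deriv ?_
        rw [mul_one]
      have hci : IntervalIntegrable (fun x => M' + M * (1 / Real.cos x ^ 2)) volume (-c) c := by
        refine ContinuousOn.intervalIntegrable ?_
        refine ContinuousOn.add (by fun_prop) (ContinuousOn.mul (by fun_prop)
          (ContinuousOn.div (by fun_prop) (by fun_prop) ?_))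
        exact fun x hx => pow_ne_zero _ (hcos' x hx)
      have := intervalIntegral.norm_integral_le_of_norm_le (μ := volume)
        (by linarith : -c ≤ c) (f := fun θ => ((q.derivative.eval (Real.sin θ) +
          q.eval (Real.sin θ) * Real.sin θ / Real.cos θ ^ 2 : ℝ) : ℂ) *
          Complex.exp (Complex.I * τ * Real.sin θ))
        (g := fun x => M' + M * (1 / Real.cos x ^ 2)) ?_ hci
      · refine this.trans ?_
        rw [intervalIntegral.integral_eq_sub_of_hasDerivAt hd hci]
        rw [Real.tan_neg]
        have htan : Real.tan c ≤ (Real.sin δ)⁻¹ := by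
          rw [Real.tan_eq_sin_div_cos, hcosc, ← one_div]
          gcongr
          exact Real.sin_le_one c
        nlinarith [mul_le_mul_of_nonneg_left htan hM0, mul_nonneg hM'0 hδ0.le]
      · refine ae_of_all _ fun x hx => ?_
        rw [norm_mul, show Complex.I * τ * Real.sin x = ((τ * Real.sin x : ℝ) : ℂ) * Complex.I by
          push_cast; ring, Complex.norm_exp_ofReal_mul_I, mul_one, Complex.norm_real]
        refine (norm_add_le _ _).trans ?_
        refine add_le_add (hM' x) ?_
        rw [Real.norm_eq_abs, abs_div, abs_mul, mul_one_div, abs_of_nonneg (sq_nonneg (Real.cos x))]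
        gcongr
        exact (mul_le_mul (hM x) (Real.abs_sin_le_one x) (abs_nonneg _) hM0).trans (by simp)
    have hend : ∀ x, Real.cos x = Real.sin δ →
        |q.eval (Real.sin x) / Real.cos x| ≤ M * (Real.sin δ)⁻¹ := fun x hx => by
      rw [hx, abs_div, abs_of_pos hsin0, div_eq_mul_inv]
      gcongr
      exact hM x
    have he1 := hend c hcosc
    have he2 := hend (-c) (by rw [Real.cos_neg, hcosc])
    calc _ ≤ τ⁻¹ * (M * (Real.sin δ)⁻¹ + M * (Real.sin δ)⁻¹ +
          (M' * Real.pi + 2 * M * (Real.sin δ)⁻¹)) := by gcongr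
      _ = τ⁻¹ * (M' * Real.pi * 1 + 4 * M * (Real.sin δ)⁻¹) := by ring
      _ ≤ τ⁻¹ * (M' * Real.pi * δ⁻¹ + 4 * M * (Real.pi / 2 * δ⁻¹)) := by
          gcongr
          exact (one_le_inv₀ hδ0).2 hδ1
      _ = _ := by rw [hδτ]; field_simp; ring
  change ‖∫ θ in (-(Real.pi / 2))..(Real.pi / 2), f θ‖ ≤ _
  rw [hsplit]
  refine (norm_add₃_le).trans ?_
  linarith

lemma exists_norm_integral_cos_pow_mul_exp_sin_le (N : ℕ) : ∀ q : Polynomial ℝ,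
    ∃ C, 0 ≤ C ∧ ∀ τ : ℝ, 1 ≤ τ →
      ‖∫ θ in (-(Real.pi / 2))..(Real.pi / 2),
        ((Real.cos θ ^ N * q.eval (Real.sin θ) : ℝ) : ℂ) *
          Complex.exp (Complex.I * τ * Real.sin θ)‖
        ≤ C * τ ^ (-((N + 1 : ℝ) / 2)) := by
  induction N using Nat.twoStepInduction with
  | zero =>
    intro q
    simpa using exists_norm_integral_eval_sin_mul_exp_sin_le q
  | one =>
    intro q
    obtain ⟨M, hM0, hM⟩ := exists_bound_eval_sin q
    obtain ⟨M', hM'0, hM'⟩ := exists_bound_eval_sin q.derivative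
    have hpi := Real.pi_pos
    refine ⟨2 * M + M' * Real.pi, by positivity, fun τ hτ => ?_⟩
    have hτ0 : 0 < τ := by linarith
    have h := norm_integral_mul_cos_mul_exp_sin_le (a := -(Real.pi / 2)) (b := Real.pi / 2) hτ0
      (u := fun θ => q.eval (Real.sin θ))
      (u' := fun θ => q.derivative.eval (Real.sin θ) * Real.cos θ)
      (fun x _ => (q.hasDerivAt (Real.sin x)).comp x (Real.hasDerivAt_sin x))
      (by have := q.derivative.continuous; fun_prop)
    have h2 := norm_integral_mul_exp_sin_le (τ := τ) (K := M')
      (by linarith : -(Real.pi / 2) ≤ Real.pi / 2)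
      (u := fun θ => q.derivative.eval (Real.sin θ) * Real.cos θ) (fun x _ => by
        rw [abs_mul]
        exact (mul_le_mul (hM' x) (Real.abs_cos_le_one x) (abs_nonneg _) hM'0).trans (by simp))
    have hexp : τ ^ (-(((1 : ℕ) + 1 : ℝ) / 2)) = τ⁻¹ := by
      rw [← Real.rpow_neg_one]; norm_num
    rw [hexp]
    have h1a := hM (-(Real.pi / 2))
    have h1b := hM (Real.pi / 2)
    calc _ = ‖∫ θ in (-(Real.pi / 2))..(Real.pi / 2),
        ((q.eval (Real.sin θ) * Real.cos θ : ℝ) : ℂ) *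
          Complex.exp (Complex.I * τ * Real.sin θ)‖ := by
          simp only [pow_one, mul_comm (Real.cos _)]
      _ ≤ _ := h
      _ ≤ τ⁻¹ * (M + M + M' * (Real.pi / 2 - -(Real.pi / 2))) := by gcongr
      _ = _ := by ring
  | more N ih _ =>
    intro q
    obtain ⟨C, hC0, hC⟩ := ih (-(N + 1 : ℝ) • (Polynomial.X * q) +
      (1 - Polynomial.X ^ 2) * q.derivative)
    refine ⟨C, hC0, fun τ hτ => ?_⟩
    have hτ0 : 0 < τ := by linarith
    have h := norm_integral_mul_cos_mul_exp_sin_le (a := -(Real.pi / 2)) (b := Real.pi / 2) hτ0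
      (u := fun θ => Real.cos θ ^ (N + 1) * q.eval (Real.sin θ))
      (u' := fun θ => Real.cos θ ^ N * (-(N + 1 : ℝ) • (Polynomial.X * q) +
        (1 - Polynomial.X ^ 2) * q.derivative).eval (Real.sin θ))
      (fun x _ => by
        have h1 := ((Real.hasDerivAt_cos x).pow (N + 1)).mul
          ((q.hasDerivAt (Real.sin x)).comp x (Real.hasDerivAt_sin x))
        refine h1.congr_deriv ?_
        simp only [Function.comp, Polynomial.eval_add, Polynomial.eval_smul, Polynomial.eval_mul,
          Polynomial.eval_X, Polynomial.eval_sub, Polynomial.eval_one, Polynomial.eval_pow,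
          smul_eq_mul, Nat.add_sub_cancel, Pi.pow_apply, ← Real.cos_sq']
        push_cast
        ring)
      (by
        have := (-(N + 1 : ℝ) • (Polynomial.X * q) +
          (1 - Polynomial.X ^ 2) * q.derivative).continuous
        fun_prop)
    have hexp : τ ^ (-(((N + 2 : ℕ) + 1 : ℝ) / 2)) = τ⁻¹ * τ ^ (-((N + 1 : ℝ) / 2)) := by
      rw [← Real.rpow_neg_one, ← Real.rpow_add hτ0]; push_cast; ring_nf
    rw [hexp]
    calc _ = ‖∫ θ in (-(Real.pi / 2))..(Real.pi / 2),
        ((Real.cos θ ^ (N + 1) * q.eval (Real.sin θ) * Real.cos θ : ℝ) : ℂ) *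
          Complex.exp (Complex.I * τ * Real.sin θ)‖ := by
          congr 2; ext θ; push_cast; ring
      _ ≤ _ := h
      _ ≤ τ⁻¹ * (0 + 0 + C * τ ^ (-((N + 1 : ℝ) / 2))) := by
          gcongr
          · simp
          · simp
          · exact hC τ hτ
      _ = _ := by ring

lemma integral_ball_prod_pow {m : ℕ} (b : Fin m → ℕ) {s : ℝ} (hs : 0 < s) :
    (∫ y : Fin m → ℝ, if ∑ i, y i ^ 2 < s then ∏ i, y i ^ b i else 0) =
      Real.sqrt s ^ (m + ∑ i, b i) *
        ∫ y : Fin m → ℝ, if ∑ i, y i ^ 2 < 1 then ∏ i, y i ^ b i else 0 := by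
  have hr : 0 < Real.sqrt s := Real.sqrt_pos.2 hs
  have h := Measure.integral_comp_smul (μ := (volume : Measure (Fin m → ℝ)))
    (fun y : Fin m → ℝ => if ∑ i, y i ^ 2 < s then ∏ i, y i ^ b i else 0) (Real.sqrt s)
  have h2 : (fun x : Fin m → ℝ => (fun y : Fin m → ℝ =>
      if ∑ i, y i ^ 2 < s then ∏ i, y i ^ b i else 0) (Real.sqrt s • x)) =
      fun x => Real.sqrt s ^ (∑ i, b i) * if ∑ i, x i ^ 2 < 1 then ∏ i, x i ^ b i else 0 := by
    ext x
    simp only [Pi.smul_apply, smul_eq_mul, mul_pow, ← Finset.mul_sum, Finset.prod_mul_distrib,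
      Finset.prod_pow_eq_pow_sum, Real.sq_sqrt hs.le, mul_ite, mul_zero]
    have : s * ∑ i, x i ^ 2 < s ↔ ∑ i, x i ^ 2 < 1 := by
      constructor <;> intro h <;> nlinarith
    simp only [this]
  rw [h2, integral_const_mul] at h
  rw [pow_add, mul_assoc, h]
  rw [Module.finrank_fin_fun, abs_of_pos (by positivity), smul_eq_mul, mul_inv_cancel_left₀]
  positivity

lemma integral_ball_prod_pow_eq_zero {m : ℕ} (b : Fin m → ℕ) {s : ℝ} (hs : s ≤ 0) :
    (∫ y : Fin m → ℝ, if ∑ i, y i ^ 2 < s then ∏ i, y i ^ b i else 0) = 0 := by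
  have : ∀ y : Fin m → ℝ, ¬ ∑ i, y i ^ 2 < s := fun y =>
    not_lt.2 (hs.trans (Finset.sum_nonneg fun i _ => sq_nonneg _))
  simp [this]

lemma integral_sqrt_pow_mul_exp (K j : ℕ) (τ : ℝ) :
    ∫ t in (-1 : ℝ)..1, ((Real.sqrt (1 - t ^ 2) ^ K * t ^ j : ℝ) : ℂ) *
      Complex.exp (Complex.I * τ * t) =
    ∫ θ in (-(Real.pi / 2))..(Real.pi / 2),
      ((Real.cos θ ^ (K + 1) * (Polynomial.X ^ j : Polynomial ℝ).eval (Real.sin θ) : ℝ) : ℂ) *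
          Complex.exp (Complex.I * τ * Real.sin θ) := by
  have h := intervalIntegral.integral_deriv_smul_comp (a := -(Real.pi / 2)) (b := Real.pi / 2)
    (f := Real.sin) (f' := Real.cos) (g := fun t : ℝ =>
      ((Real.sqrt (1 - t ^ 2) ^ K * t ^ j : ℝ) : ℂ) * Complex.exp (Complex.I * τ * t))
    (fun x _ => Real.hasDerivAt_sin x) (by fun_prop) (by fun_prop)
  rw [Real.sin_neg, Real.sin_pi_div_two] at h
  rw [← h]
  refine intervalIntegral.integral_congr fun θ hθ => ?_
  rw [Set.uIcc_of_le (by linarith [Real.pi_pos])] at hθ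
  simp only [Function.comp, Complex.real_smul, Polynomial.eval_pow, Polynomial.eval_X]
  rw [← Real.cos_eq_sqrt_one_sub_sin_sq hθ.1 hθ.2]
  push_cast
  ring

lemma setIntegral_closedBall_eq_ball {m : ℕ} (f : EuclideanSpace ℝ (Fin (m + 1)) → ℂ) :
    ∫ x in Metric.closedBall 0 1, f x = ∫ x in Metric.ball 0 1, f x := by
  refine (setIntegral_congr_set (ae_eq_of_subset_of_measure_ge Metric.ball_subset_closedBall
    ?_ measurableSet_ball.nullMeasurableSet ?_)).symm
  · rw [Measure.addHaar_closedBall_eq_addHaar_ball]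
  · exact measure_closedBall_lt_top.ne

lemma integral_closedBall_prod_pow_mul_exp {m : ℕ} (b : Fin (m + 1) → ℕ) (τ : ℝ) :
    ∫ x in Metric.closedBall (0 : EuclideanSpace ℝ (Fin (m + 1))) 1,
      ((∏ i, x i ^ b i : ℝ) : ℂ) * Complex.exp (Complex.I * τ * x 0) =
    ((∫ y : Fin m → ℝ, if ∑ i, y i ^ 2 < 1 then ∏ i : Fin m, y i ^ b i.succ else 0 : ℝ) : ℂ) *
      ∫ t in (-1 : ℝ)..1, ((Real.sqrt (1 - t ^ 2) ^ (m + ∑ i : Fin m, b i.succ) * t ^ b 0 : ℝ) : ℂ)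
        * Complex.exp (Complex.I * τ * t) := by
  rw [setIntegral_closedBall_eq_ball, ← integral_indicator measurableSet_ball]
  set f : EuclideanSpace ℝ (Fin (m + 1)) → ℂ := (Metric.ball 0 1).indicator fun x =>
    ((∏ i, x i ^ b i : ℝ) : ℂ) * Complex.exp (Complex.I * τ * x 0) with hf
  have hfint : Integrable f := by
    refine IntegrableOn.integrable_indicator ?_ measurableSet_ball
    refine IntegrableOn.mono_set ?_ Metric.ball_subset_closedBall
    exact ContinuousOn.integrableOn_compact (isCompact_closedBall _ _) (by fun_prop)
  let e := (MeasurableEquiv.piFinSuccAbove (fun _ : Fin (m + 1) => ℝ) 0).symm.trans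
    (MeasurableEquiv.toLp 2 (Fin (m + 1) → ℝ))
  have he : MeasurePreserving e :=
    (PiLp.volume_preserving_toLp (Fin (m + 1))).comp
      (volume_preserving_piFinSuccAbove (fun _ : Fin (m + 1) => ℝ) 0).symm
  have hval : ∀ t y, f (e (t, y)) = ((t ^ b 0 : ℝ) : ℂ) * Complex.exp (Complex.I * τ * t) *
      ((if ∑ i, y i ^ 2 < 1 - t ^ 2 then ∏ i : Fin m, y i ^ b i.succ else 0 : ℝ) : ℂ) := by
    intro t y
    have h0 : (e (t, y)) 0 = t := rfl
    have h1 : ∀ i : Fin m, (e (t, y)) i.succ = y i := fun i => rfl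
    have hmem : e (t, y) ∈ Metric.ball (0 : EuclideanSpace ℝ (Fin (m + 1))) 1 ↔
        ∑ i, y i ^ 2 < 1 - t ^ 2 := by
      rw [mem_ball_zero_iff, ← sq_lt_one_iff₀ (norm_nonneg _), EuclideanSpace.norm_sq_eq,
        Fin.sum_univ_succ]
      simp only [h0, h1, Real.norm_eq_abs, sq_abs]
      constructor <;> intro h <;> linarith
    by_cases h : ∑ i, y i ^ 2 < 1 - t ^ 2
    · rw [hf, Set.indicator_of_mem (hmem.2 h), if_pos h]
      simp only [Fin.prod_univ_succ, h0, h1]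
      push_cast
      ring
    · rw [hf, Set.indicator_of_notMem (fun h' => h (hmem.1 h')), if_neg h]
      simp
  have hint : Integrable (fun z => f (e z)) := (he.integrable_comp_emb e.measurableEmbedding).2 hfint
  rw [← he.integral_comp e.measurableEmbedding f, Measure.volume_eq_prod, integral_prod _ hint]
  simp only [hval]
  simp_rw [integral_const_mul, integral_complex_ofReal]
  rw [intervalIntegral.integral_of_le (by norm_num), ← integral_const_mul,
    integral_Ioc_eq_integral_Ioo, ← integral_indicator measurableSet_Ioo]
  congr 1
  ext t
  rw [Set.indicator_apply]
  split_ifs with ht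
  · rw [integral_ball_prod_pow _ (by nlinarith [ht.1, ht.2])]
    push_cast
    ring
  · rw [integral_ball_prod_pow_eq_zero]
    · simp
    · by_contra! hlt
      exact ht (abs_lt.1 (by rw [← sq_lt_one_iff_abs_lt_one]; linarith))

lemma exists_norm_integral_closedBall_eval_mul_exp_le {m : ℕ}
    (M : MvPolynomial (Fin (m + 1)) ℝ) :
    ∃ C, 0 ≤ C ∧ ∀ τ : ℝ, 1 ≤ τ →
      ‖∫ x in Metric.closedBall (0 : EuclideanSpace ℝ (Fin (m + 1))) 1,
        ((MvPolynomial.eval (fun i => x i) M : ℝ) : ℂ) * Complex.exp (Complex.I * τ * x 0)‖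
      ≤ C * τ ^ (-((m + 2 : ℝ) / 2)) := by
  induction M using MvPolynomial.induction_on' with
  | monomial u a =>
    obtain ⟨C, hC0, hC⟩ := exists_norm_integral_cos_pow_mul_exp_sin_le
      (m + ∑ i : Fin m, u i.succ + 1) (Polynomial.X ^ u 0)
    set G : ℝ := ∫ y : Fin m → ℝ,
      if ∑ i, y i ^ 2 < 1 then ∏ i : Fin m, y i ^ u i.succ else 0 with hG
    refine ⟨|a| * (|G| * C), by positivity, fun τ hτ => ?_⟩
    have h1 : ∀ x : EuclideanSpace ℝ (Fin (m + 1)),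
        ((MvPolynomial.eval (fun i => x i) (MvPolynomial.monomial u a) : ℝ) : ℂ) *
          Complex.exp (Complex.I * τ * x 0) =
        (a : ℂ) * (((∏ i, x i ^ u i : ℝ) : ℂ) * Complex.exp (Complex.I * τ * x 0)) := by
      intro x
      rw [MvPolynomial.eval_monomial, Finsupp.prod_fintype _ _ (by simp)]
      push_cast
      ring
    simp_rw [h1]
    rw [integral_const_mul, integral_closedBall_prod_pow_mul_exp, integral_sqrt_pow_mul_exp,
      norm_mul, norm_mul, Complex.norm_real, Complex.norm_real, ← hG, Real.norm_eq_abs,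
      Real.norm_eq_abs, mul_assoc, mul_assoc]
    gcongr
    refine (hC τ hτ).trans ?_
    refine mul_le_mul_of_nonneg_left (Real.rpow_le_rpow_of_exponent_le hτ ?_) hC0
    · push_cast
      have : (0 : ℝ) ≤ ∑ i : Fin m, (u i.succ : ℝ) := Finset.sum_nonneg fun _ _ => by positivity
      linarith
  | add p q hp hq =>
    obtain ⟨C, hC0, hC⟩ := hp
    obtain ⟨D, hD0, hD⟩ := hq
    refine ⟨C + D, by positivity, fun τ hτ => ?_⟩
    have hi : ∀ p : MvPolynomial (Fin (m + 1)) ℝ,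
        IntegrableOn (fun x : EuclideanSpace ℝ (Fin (m + 1)) =>
          ((MvPolynomial.eval (fun i => x i) p : ℝ) : ℂ) * Complex.exp (Complex.I * τ * x 0))
          (Metric.closedBall 0 1) := fun p => by
      have : Continuous fun x : EuclideanSpace ℝ (Fin (m + 1)) =>
          MvPolynomial.eval (fun i => x i) p :=
        (MvPolynomial.continuous_eval p).comp (by fun_prop)
      exact ContinuousOn.integrableOn_compact (isCompact_closedBall _ _) (by fun_prop)
    simp_rw [map_add, Complex.ofReal_add, add_mul]
    rw [integral_add (hi p) (hi q)]
    exact (norm_add_le _ _).trans (add_le_add (hC τ hτ) (hD τ hτ))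

lemma continuous_eval_euclidean {n : ℕ} (P : MvPolynomial (Fin n) ℝ) :
    Continuous fun x : EuclideanSpace ℝ (Fin n) => MvPolynomial.eval (fun i => x i) P :=
  (MvPolynomial.continuous_eval P).comp (by fun_prop)

lemma exists_norm_integral_closedBall_eval_isometry_mul_exp_le {m : ℕ}
    (P : MvPolynomial (Fin (m + 1)) ℝ) : ∀ M : MvPolynomial (Fin (m + 1)) ℝ,
    ∃ C, 0 ≤ C ∧ ∀ (U : EuclideanSpace ℝ (Fin (m + 1)) ≃ₗᵢ[ℝ] EuclideanSpace ℝ (Fin (m + 1)))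
      (τ : ℝ), 1 ≤ τ →
      ‖∫ x in Metric.closedBall (0 : EuclideanSpace ℝ (Fin (m + 1))) 1,
        ((MvPolynomial.eval (fun i => U x i) P : ℝ) : ℂ) *
          (((MvPolynomial.eval (fun i => x i) M : ℝ) : ℂ) * Complex.exp (Complex.I * τ * x 0))‖
      ≤ C * τ ^ (-((m + 2 : ℝ) / 2)) := by
  have hi : ∀ (U : EuclideanSpace ℝ (Fin (m + 1)) ≃ₗᵢ[ℝ] EuclideanSpace ℝ (Fin (m + 1)))
      (τ : ℝ) (p M : MvPolynomial (Fin (m + 1)) ℝ),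
        IntegrableOn (fun x : EuclideanSpace ℝ (Fin (m + 1)) =>
          ((MvPolynomial.eval (fun i => U x i) p : ℝ) : ℂ) *
          (((MvPolynomial.eval (fun i => x i) M : ℝ) : ℂ) * Complex.exp (Complex.I * τ * x 0)))
          (Metric.closedBall 0 1) := fun U τ p M => by
    have h1 := (continuous_eval_euclidean p).comp U.continuous
    have h2 := continuous_eval_euclidean M
    simp only [Function.comp_def] at h1
    exact ContinuousOn.integrableOn_compact (isCompact_closedBall _ _) (by fun_prop)
  induction P using MvPolynomial.induction_on with
  | C a =>
    intro M
    obtain ⟨C, hC0, hC⟩ := exists_norm_integral_closedBall_eval_mul_exp_le M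
    refine ⟨|a| * C, by positivity, fun U τ hτ => ?_⟩
    simp_rw [MvPolynomial.eval_C]
    rw [integral_const_mul, norm_mul, Complex.norm_real, Real.norm_eq_abs, mul_assoc]
    exact mul_le_mul_of_nonneg_left (hC τ hτ) (abs_nonneg _)
  | add p q hp hq =>
    intro M
    obtain ⟨C, hC0, hC⟩ := hp M
    obtain ⟨D, hD0, hD⟩ := hq M
    refine ⟨C + D, by positivity, fun U τ hτ => ?_⟩
    simp_rw [map_add, Complex.ofReal_add, add_mul]
    rw [integral_add (hi U τ p M) (hi U τ q M)]
    exact (norm_add_le _ _).trans (add_le_add (hC U τ hτ) (hD U τ hτ))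
  | mul_X p i hp =>
    intro M
    choose C hC0 hC using fun j => hp (M * MvPolynomial.X j)
    refine ⟨∑ j, C j, Finset.sum_nonneg fun j _ => hC0 j, fun U τ hτ => ?_⟩
    set c : Fin (m + 1) → ℝ := fun j => U (EuclideanSpace.single j 1) i with hc
    have hc1 : ∀ j, |c j| ≤ 1 := fun j => by
      have h := PiLp.norm_apply_le (U (EuclideanSpace.single j 1)) i
      simpa using h
    have hU : ∀ x : EuclideanSpace ℝ (Fin (m + 1)), U x i = ∑ j, c j * x j := fun x => by
      have hx : x = ∑ j, x j • EuclideanSpace.single j (1 : ℝ) := by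
        ext k
        simp [Finset.sum_apply, Pi.single_apply]
      conv_lhs => rw [hx]
      simp only [map_sum, map_smul, hc]
      simp [mul_comm]
    have hx : ∀ x : EuclideanSpace ℝ (Fin (m + 1)),
        ((MvPolynomial.eval (fun i => U x i) (p * MvPolynomial.X i) : ℝ) : ℂ) *
          (((MvPolynomial.eval (fun i => x i) M : ℝ) : ℂ) * Complex.exp (Complex.I * τ * x 0)) =
        ∑ j, (c j : ℂ) * (((MvPolynomial.eval (fun i => U x i) p : ℝ) : ℂ) *
          (((MvPolynomial.eval (fun i => x i) (M * MvPolynomial.X j) : ℝ) : ℂ) *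
            Complex.exp (Complex.I * τ * x 0))) := fun x => by
      rw [map_mul, MvPolynomial.eval_X, hU]
      push_cast
      rw [Finset.mul_sum, Finset.sum_mul]
      refine Finset.sum_congr rfl fun j _ => ?_
      rw [map_mul, MvPolynomial.eval_X]
      push_cast
      ring
    simp_rw [hx]
    rw [integral_finsetSum _ fun j _ => (hi U τ p _).const_mul _, Finset.sum_mul]
    refine (norm_sum_le _ _).trans (Finset.sum_le_sum fun j _ => ?_)
    rw [integral_const_mul, norm_mul, Complex.norm_real, Real.norm_eq_abs]
    exact (mul_le_of_le_one_left (norm_nonneg _) (hc1 j)).trans (hC j U τ hτ)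

lemma exists_norm_fourier_closedBall_le {n : ℕ} (hn : 2 ≤ n) (P : MvPolynomial (Fin n) ℝ) :
    ∃ C, 0 ≤ C ∧ ∀ ξ : EuclideanSpace ℝ (Fin n), 1 ≤ ‖ξ‖ →
      ‖∫ x in Metric.closedBall (0 : EuclideanSpace ℝ (Fin n)) 1,
        Complex.exp (-(2 * Real.pi * Complex.I * (inner ℝ x ξ : ℝ))) *
          ((MvPolynomial.eval (fun i => x i) P : ℝ) : ℂ)‖
      ≤ C * ‖ξ‖ ^ (-((n + 1 : ℝ) / 2)) := by
  obtain ⟨m, rfl⟩ : ∃ m, n = m + 1 := ⟨n - 1, by omega⟩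
  obtain ⟨C, hC0, hC⟩ := exists_norm_integral_closedBall_eval_isometry_mul_exp_le P 1
  refine ⟨C, hC0, fun ξ hξ => ?_⟩
  have hξ0 : 0 < ‖ξ‖ := by linarith
  have hτ : ‖ξ‖ ≤ 2 * Real.pi * ‖ξ‖ := by nlinarith [Real.pi_gt_three]
  obtain ⟨b, hb⟩ := Orthonormal.exists_orthonormalBasis_extension_of_card_eq (𝕜 := ℝ)
    (E := EuclideanSpace ℝ (Fin (m + 1))) (ι := Fin (m + 1)) (by simp)
    (v := fun _ => -(‖ξ‖⁻¹ • ξ)) (s := {0}) (by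
      rw [orthonormal_iff_ite]
      have hnorm : ‖‖ξ‖⁻¹ • ξ‖ = 1 := by
        rw [norm_smul, norm_inv, norm_norm, inv_mul_cancel₀ hξ0.ne']
      rintro ⟨i, rfl⟩ ⟨j, rfl⟩
      simp [hnorm])
  have hb0 : ξ = -(‖ξ‖ • b 0) := by
    rw [hb 0 rfl]
    simp [smul_smul, hξ0.ne']
  have hin : ∀ x, inner ℝ (b.repr.symm x) ξ = -(‖ξ‖ * x 0) := fun x => by
    conv_lhs => rw [hb0]
    rw [inner_neg_right, inner_smul_right, real_inner_comm, ← b.repr_apply_apply]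
    simp
  have hpre : b.repr.symm ⁻¹' Metric.closedBall 0 1 = Metric.closedBall 0 1 := by
    rw [b.repr.symm.preimage_closedBall]; simp
  have h := hC b.repr.symm (2 * Real.pi * ‖ξ‖) (by linarith)
  rw [← (b.repr.symm.measurePreserving).setIntegral_preimage_emb
    b.repr.symm.toHomeomorph.measurableEmbedding, hpre]
  have hfun : ∀ x : EuclideanSpace ℝ (Fin (m + 1)),
      Complex.exp (-(2 * Real.pi * Complex.I * (inner ℝ (b.repr.symm x) ξ : ℝ))) *
          ((MvPolynomial.eval (fun i => b.repr.symm x i) P : ℝ) : ℂ) =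
      ((MvPolynomial.eval (fun i => b.repr.symm x i) P : ℝ) : ℂ) *
          (((MvPolynomial.eval (fun i => x i) (1 : MvPolynomial (Fin (m + 1)) ℝ) : ℝ) : ℂ) *
            Complex.exp (Complex.I * (2 * Real.pi * ‖ξ‖ : ℝ) * x 0)) := fun x => by
    rw [hin, map_one, Complex.ofReal_one, one_mul, mul_comm]
    congr 2
    push_cast
    ring
  simp_rw [hfun]
  refine h.trans ?_
  have hexp : -(((m + 1 : ℕ) + 1 : ℝ) / 2) = -((m + 2 : ℝ) / 2) := by push_cast; ring
  rw [hexp]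
  refine mul_le_mul_of_nonneg_left ?_ hC0
  exact Real.rpow_le_rpow_of_nonpos hξ0 hτ (by
    have : (0 : ℝ) ≤ m := by positivity
    linarith)

/-- The half-open unit cube `(0, 1]ⁿ`. -/
def unitCube (n : ℕ) : Set (Fin n → ℝ) := {x | ∀ i, x i ∈ Set.Ioc 0 1}

lemma measurableSet_unitCube (n : ℕ) : MeasurableSet (unitCube n) := by
  have : unitCube n = Set.univ.pi fun _ => Set.Ioc 0 1 := by ext; simp [unitCube]
  rw [this]
  exact MeasurableSet.univ_pi fun _ => measurableSet_Ioc

lemma volume_unitCube (n : ℕ) : volume (unitCube n) = 1 := by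
  have : unitCube n = Set.univ.pi fun _ => Set.Ioc 0 1 := by ext; simp [unitCube]
  rw [this, volume_pi_pi]
  simp

/-- The real vector underlying an integer vector. -/
def intVec {n : ℕ} (k : Fin n → ℤ) : Fin n → ℝ := fun i => k i

/-- The translate of the unit cube by an integer vector. -/
def intCube {n : ℕ} (k : Fin n → ℤ) : Set (Fin n → ℝ) :=
  (fun x => x + intVec (-k)) ⁻¹' unitCube n

lemma mem_intCube_iff {n : ℕ} {k : Fin n → ℤ} {x : Fin n → ℝ} :
    x ∈ intCube k ↔ (fun i => ⌈x i⌉ - 1) = k := by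
  simp only [intCube, unitCube, intVec, Set.mem_preimage, Set.mem_ofPred_eq, Set.mem_Ioc,
    Pi.add_apply, Pi.neg_apply, Int.cast_neg, funext_iff, sub_eq_iff_eq_add]
  refine forall_congr' fun i => ?_
  rw [Int.ceil_eq_iff]
  push_cast
  constructor <;> rintro ⟨h1, h2⟩ <;> constructor <;> linarith

lemma iUnion_intCube (n : ℕ) : ⋃ k : Fin n → ℤ, intCube k = Set.univ := by
  ext x; simp [mem_intCube_iff]

lemma pairwise_disjoint_intCube (n : ℕ) :
    Pairwise (Function.onFun Disjoint (intCube : (Fin n → ℤ) → Set (Fin n → ℝ))) := by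
  intro k l hkl
  refine Set.disjoint_left.2 fun x hk hl => hkl ?_
  rw [← mem_intCube_iff.1 hk, mem_intCube_iff.1 hl]

lemma measurableSet_intCube {n : ℕ} (k : Fin n → ℤ) : MeasurableSet (intCube k) :=
  (measurableSet_unitCube n).preimage (measurable_add_const _)

lemma intVec_neg_add {n : ℕ} (k : Fin n → ℤ) (x : Fin n → ℝ) :
    x + intVec (-k) + intVec k = x := by
  ext i; simp [intVec]

lemma lintegral_eq_tsum_unitCube {n : ℕ} (f : (Fin n → ℝ) → ENNReal) :
    ∫⁻ x, f x = ∑' k : Fin n → ℤ, ∫⁻ x in unitCube n, f (x + intVec k) := by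
  rw [← setLIntegral_univ, ← iUnion_intCube,
    lintegral_iUnion measurableSet_intCube (pairwise_disjoint_intCube n)]
  refine tsum_congr fun k => ?_
  have h := (measurePreserving_add_right volume (intVec (-k))).setLIntegral_comp_preimage_emb
    (measurableEmbedding_addRight _) (fun x => f (x + intVec k)) (unitCube n)
  simp only [intVec_neg_add] at h
  exact h

lemma hasSum_integral_unitCube {n : ℕ} {f : (Fin n → ℝ) → ℂ} (hf : Integrable f) :
    HasSum (fun k : Fin n → ℤ => ∫ x in unitCube n, f (x + intVec k)) (∫ x, f x) := by
  have h := hasSum_integral_iUnion (μ := volume) (f := f) measurableSet_intCube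
    (pairwise_disjoint_intCube n) hf.integrableOn
  rw [iUnion_intCube, setIntegral_univ] at h
  refine (funext fun k => ?_ : (fun k : Fin n → ℤ => ∫ x in unitCube n, f (x + intVec k)) =
    fun k => ∫ x in intCube k, f x) ▸ h
  have h := (measurePreserving_add_right volume (intVec (-k))).setIntegral_preimage_emb
    (measurableEmbedding_addRight _) (fun x => f (x + intVec k)) (unitCube n)
  simp only [intVec_neg_add] at h
  exact h.symm

lemma integrable_norm_rpow_mul_one_add_norm_rpow {n : ℕ} (hn : n ≠ 0) {s : ℝ} (hs : 0 < s)
    (hsn : s < n) :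
    Integrable fun x : Fin n → ℝ => ‖x‖ ^ (-s) * (1 + ‖x‖) ^ (-n : ℝ) := by
  have : Nonempty (Fin n) := ⟨⟨0, Nat.pos_of_ne_zero hn⟩⟩
  have h := integrable_fun_norm_addHaar (E := Fin n → ℝ) (μ := volume)
    (f := fun r : ℝ => r ^ (-s) * (1 + r) ^ (-n : ℝ))
  refine h.2 ?_
  have hmeas : Measurable fun y : ℝ =>
      y ^ (Module.finrank ℝ (Fin n → ℝ) - 1) • (y ^ (-s) * (1 + y) ^ (-n : ℝ)) := by
    simp only [smul_eq_mul]; fun_prop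
  have hpow : ∀ y : ℝ, 0 < y → y ^ (Module.finrank ℝ (Fin n → ℝ) - 1) * y ^ (-s) =
      y ^ (n - 1 - s : ℝ) := fun y hy => by
    rw [Module.finrank_fin_fun, ← Real.rpow_natCast, ← Real.rpow_add hy,
      Nat.cast_sub (Nat.one_le_iff_ne_zero.2 hn)]
    ring_nf
  rw [← Set.Ioc_union_Ioi_eq_Ioi zero_le_one]
  refine IntegrableOn.union ?_ ?_
  · have h1 : IntegrableOn (fun y : ℝ => y ^ (n - 1 - s : ℝ)) (Set.Ioc 0 1) :=
      (intervalIntegrable_iff_integrableOn_Ioc_of_le zero_le_one).1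
        (intervalIntegral.intervalIntegrable_rpow' (by linarith))
    refine h1.mono' hmeas.aestronglyMeasurable ?_
    filter_upwards [ae_restrict_mem measurableSet_Ioc] with y hy
    have hy0 : 0 < y := hy.1
    rw [smul_eq_mul, ← mul_assoc, hpow y hy0, Real.norm_of_nonneg (by positivity)]
    refine mul_le_of_le_one_right (by positivity) ?_
    exact Real.rpow_le_one_of_one_le_of_nonpos (by linarith) (by simp)
  · have h1 : IntegrableOn (fun y : ℝ => y ^ (-1 - s : ℝ)) (Set.Ioi 1) :=
      integrableOn_Ioi_rpow_of_lt (by linarith) zero_lt_one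
    refine h1.mono' hmeas.aestronglyMeasurable ?_
    filter_upwards [ae_restrict_mem measurableSet_Ioi] with y hy
    have hy0 : 0 < y := zero_lt_one.trans hy
    rw [smul_eq_mul, ← mul_assoc, hpow y hy0, Real.norm_of_nonneg (by positivity)]
    rw [show (-1 - s : ℝ) = (n - 1 - s) + -n by ring, Real.rpow_add hy0]
    refine mul_le_mul_of_nonneg_left ?_ (by positivity)
    exact Real.rpow_le_rpow_of_nonpos hy0 (by linarith) (by simp)

lemma one_le_norm_intVec {n : ℕ} {k : Fin n → ℤ} (hk : k ≠ 0) : 1 ≤ ‖intVec k‖ := by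
  obtain ⟨i, hi⟩ := Function.ne_iff.1 hk
  refine le_trans ?_ (norm_le_pi_norm (intVec k) i)
  rw [intVec, Real.norm_eq_abs, ← Int.cast_abs]
  exact_mod_cast Int.one_le_abs hi

lemma norm_unitCube_le {n : ℕ} {x : Fin n → ℝ} (hx : x ∈ unitCube n) : ‖x‖ ≤ 1 := by
  refine (pi_norm_le_iff_of_nonneg zero_le_one).2 fun i => ?_
  rw [Real.norm_of_nonneg (hx i).1.le]
  exact (hx i).2

lemma exists_sum_norm_rpow_mul_le {n : ℕ} (hn : n ≠ 0) {s : ℝ} (hs : 0 < s) (hsn : s < n) :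
    ∃ C, 0 ≤ C ∧ ∀ ε : ℝ, 0 < ε → ∀ S : Finset (Fin n → ℤ), (∀ k ∈ S, k ≠ 0) →
      ∑ k ∈ S, ‖intVec k‖ ^ (-s) * (1 + ε * ‖intVec k‖) ^ (-n : ℝ) ≤ C * ε ^ (s - n) := by
  have : Nonempty (Fin n) := ⟨⟨0, Nat.pos_of_ne_zero hn⟩⟩
  set h : (Fin n → ℝ) → ℝ := fun x => ‖x‖ ^ (-s) * (1 + ‖x‖) ^ (-n : ℝ) with hh
  have hint : Integrable h := integrable_norm_rpow_mul_one_add_norm_rpow hn hs hsn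
  have hh0 : ∀ x, 0 ≤ h x := fun x => by positivity
  refine ⟨2 ^ n * ∫ x, h x, mul_nonneg (by positivity) (integral_nonneg hh0), fun ε hε S hS => ?_⟩
  set ψ : (Fin n → ℝ) → ℝ := fun x => ε ^ s * h ((ε / 2) • x) with hψ
  have hε2 : ε / 2 ≠ 0 := by positivity
  have hψint : Integrable ψ := (hint.comp_smul hε2).const_mul _
  have hψ0 : ∀ x, 0 ≤ ψ x := fun x => mul_nonneg (by positivity) (hh0 _)
  have hψval : ∫ x, ψ x = 2 ^ n * (∫ x, h x) * ε ^ (s - n) := by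
    rw [integral_const_mul, Measure.integral_comp_smul, Module.finrank_fin_fun,
      abs_of_pos (by positivity), smul_eq_mul, Real.rpow_sub hε, Real.rpow_natCast, div_pow, inv_div]
    ring
  have hcmp : ∀ k : Fin n → ℤ, k ≠ 0 → ∀ x ∈ unitCube n, x ≠ -intVec k →
      ‖intVec k‖ ^ (-s) * (1 + ε * ‖intVec k‖) ^ (-n : ℝ) ≤ ψ (x + intVec k) := by
    intro k hk x hx hxk
    have h1 := one_le_norm_intVec hk
    have h2 : ‖x + intVec k‖ ≤ 2 * ‖intVec k‖ := by
      linarith [norm_add_le x (intVec k), norm_unitCube_le hx]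
    have h3 : 0 < ‖x + intVec k‖ := norm_pos_iff.2 fun h0 => hxk (eq_neg_of_add_eq_zero_left h0)
    have h4 : ε / 2 * ‖x + intVec k‖ ≤ ε * ‖intVec k‖ := by nlinarith
    simp only [hψ, hh, norm_smul, Real.norm_of_nonneg (by positivity : 0 ≤ ε / 2)]
    rw [← mul_assoc]
    refine mul_le_mul ?_ ?_ (by positivity) (by positivity)
    · rw [show ‖intVec k‖ ^ (-s) = ε ^ s * (ε * ‖intVec k‖) ^ (-s) by
        rw [Real.mul_rpow hε.le (norm_nonneg _), ← mul_assoc, ← Real.rpow_add hε]; simp]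
      refine mul_le_mul_of_nonneg_left ?_ (by positivity)
      exact Real.rpow_le_rpow_of_nonpos (by positivity) h4 (by linarith)
    · exact Real.rpow_le_rpow_of_nonpos (by positivity) (by linarith) (by simp)
  rw [← hψval, ← ENNReal.ofReal_le_ofReal_iff (integral_nonneg hψ0),
    ENNReal.ofReal_sum_of_nonneg fun k _ => by positivity,
    ofReal_integral_eq_lintegral_ofReal hψint (ae_of_all _ hψ0),
    lintegral_eq_tsum_unitCube]
  refine le_trans (Finset.sum_le_sum fun k hk => ?_) (ENNReal.sum_le_tsum S)
  calc _ = ∫⁻ x in unitCube n,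
        ENNReal.ofReal (‖intVec k‖ ^ (-s) * (1 + ε * ‖intVec k‖) ^ (-n : ℝ)) := by
        rw [setLIntegral_const, volume_unitCube, mul_one]
    _ ≤ _ := by
        refine lintegral_mono_ae ?_
        filter_upwards [ae_restrict_mem (measurableSet_unitCube n),
          ae_restrict_of_ae (compl_mem_ae_iff.2 (measure_singleton (-intVec k)))] with x hx hxk
        exact ENNReal.ofReal_le_ofReal (hcmp k (hS k hk) x hx hxk)

lemma summable_one_add_norm_intVec_rpow {n : ℕ} (hn : 2 ≤ n) :
    Summable fun k : Fin n → ℤ => (1 + ‖intVec k‖) ^ (-(n + 1) : ℝ) := by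
  obtain ⟨C, -, hC⟩ := exists_sum_norm_rpow_mul_le (n := n) (by omega) one_pos
    (by exact_mod_cast hn)
  refine summable_of_sum_le (c := 1 + C) (fun k => by positivity) fun S => ?_
  have h0 : ∑ k ∈ S.erase 0, (1 + ‖intVec k‖) ^ (-(n + 1) : ℝ) ≤ C := by
    have h := hC 1 one_pos (S.erase 0) fun k hk => Finset.ne_of_mem_erase hk
    rw [Real.one_rpow, mul_one] at h
    refine (Finset.sum_le_sum fun k hk => ?_).trans h
    have h1 := one_le_norm_intVec (Finset.ne_of_mem_erase hk)
    rw [one_mul, show (-(n + 1) : ℝ) = -1 + -n by ring, Real.rpow_add (by positivity)]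
    exact mul_le_mul_of_nonneg_right
      (Real.rpow_le_rpow_of_nonpos (by linarith) (by linarith) (by norm_num)) (by positivity)
  calc ∑ k ∈ S, (1 + ‖intVec k‖) ^ (-(n + 1) : ℝ)
      ≤ ∑ k ∈ insert 0 (S.erase 0), (1 + ‖intVec k‖) ^ (-(n + 1) : ℝ) :=
        Finset.sum_le_sum_of_subset_of_nonneg (fun k hk => by
          by_cases h : k = 0 <;> simp [h, hk]) fun _ _ _ => by positivity
    _ ≤ 1 + C := by
        rw [Finset.sum_insert (Finset.notMem_erase _ _)]
        gcongr
        exact Real.rpow_le_one_of_one_le_of_nonpos (by linarith [norm_nonneg (intVec (0 : Fin n → ℤ))])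
          (by linarith [(n.cast_nonneg : (0 : ℝ) ≤ n)])

lemma one_add_norm_add_rpow_le {E : Type*} [NormedAddCommGroup E] {a M : ℝ} (ha : 0 ≤ a)
    (x y : E) (hx : ‖x‖ ≤ M) :
    (1 + ‖x + y‖) ^ (-a) ≤ (1 + M) ^ a * (1 + ‖y‖) ^ (-a) := by
  have hM : 0 ≤ M := (norm_nonneg x).trans hx
  have h1 : ‖y‖ ≤ ‖x + y‖ + M := by
    have := norm_sub_le (x + y) x
    rw [add_sub_cancel_left] at this
    linarith
  have h2 : (1 + ‖y‖) / (1 + M) ≤ 1 + ‖x + y‖ := by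
    rw [div_le_iff₀ (by positivity)]
    nlinarith [norm_nonneg (x + y)]
  calc (1 + ‖x + y‖) ^ (-a) ≤ ((1 + ‖y‖) / (1 + M)) ^ (-a) :=
        Real.rpow_le_rpow_of_nonpos (by positivity) h2 (by linarith)
    _ = (1 + M) ^ a * (1 + ‖y‖) ^ (-a) := by
        rw [Real.div_rpow (by positivity) (by positivity), Real.rpow_neg (by positivity : 0 ≤ 1 + M)]
        field_simp

lemma norm_translate_intVec_le {n : ℕ} {f : (Fin n → ℝ) → ℂ} {C : ℝ}
    (hC : ∀ x, ‖f x‖ ≤ C * (1 + ‖x‖) ^ (-(n + 1) : ℝ)) {M : ℝ} {x : Fin n → ℝ} (hx : ‖x‖ ≤ M)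
    (l : Fin n → ℤ) :
    ‖f (x + intVec l)‖ ≤ C * (1 + M) ^ (n + 1 : ℝ) * (1 + ‖intVec l‖) ^ (-(n + 1) : ℝ) := by
  have hC0 : 0 ≤ C := by
    have := (norm_nonneg _).trans (hC 0)
    simpa using this
  refine (hC _).trans ?_
  rw [mul_assoc]
  gcongr
  exact one_add_norm_add_rpow_le (by positivity) _ _ hx

lemma continuous_tsum_translate_intVec {n : ℕ} (hn : 2 ≤ n) {f : (Fin n → ℝ) → ℂ}
    (hf : Continuous f) {C : ℝ} (hC : ∀ x, ‖f x‖ ≤ C * (1 + ‖x‖) ^ (-(n + 1) : ℝ)) :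
    Continuous fun x => ∑' l : Fin n → ℤ, f (x + intVec l) := by
  rw [continuous_iff_continuousAt]
  intro x
  have h : ContinuousOn (fun x => ∑' l : Fin n → ℤ, f (x + intVec l))
      (Metric.closedBall 0 (‖x‖ + 1)) := by
    refine continuousOn_tsum (fun l => (hf.comp (by fun_prop)).continuousOn)
      ((summable_one_add_norm_intVec_rpow hn).mul_left (C * (1 + (‖x‖ + 1)) ^ (n + 1 : ℝ))) ?_
    intro l y hy
    exact norm_translate_intVec_le hC (by simpa using hy) l
  refine h.continuousAt (Filter.mem_of_superset (Metric.ball_mem_nhds x one_pos) fun y hy => ?_)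
  have := norm_sub_norm_le y x
  rw [mem_ball_iff_norm] at hy
  simp only [mem_closedBall_iff_norm, sub_zero]
  linarith

/-- The additive character `x ↦ exp (2πi ⟨k, x⟩)` of `ℝⁿ`. -/
noncomputable def latticeChar {n : ℕ} (k : Fin n → ℤ) (x : Fin n → ℝ) : ℂ :=
  Complex.exp (2 * Real.pi * Complex.I * ((∑ i, k i * x i : ℝ) : ℂ))

lemma mFourier_coe_eq_latticeChar {n : ℕ} (k : Fin n → ℤ) (x : Fin n → ℝ) :
    UnitAddTorus.mFourier k (fun i => (x i : UnitAddCircle)) = latticeChar k x := by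
  simp only [UnitAddTorus.mFourier, ContinuousMap.coe_mk, fourier_coe_apply, latticeChar]
  rw [← Complex.exp_sum]
  congr 1
  push_cast
  rw [Finset.mul_sum]
  refine Finset.sum_congr rfl fun i _ => by ring

lemma continuous_latticeChar {n : ℕ} (k : Fin n → ℤ) : Continuous (latticeChar k) := by
  unfold latticeChar; fun_prop

lemma norm_latticeChar {n : ℕ} (k : Fin n → ℤ) (x : Fin n → ℝ) : ‖latticeChar k x‖ = 1 := by
  rw [latticeChar, mul_right_comm, ← Complex.ofReal_ofNat, ← Complex.ofReal_mul,
    ← Complex.ofReal_mul, Complex.norm_exp_ofReal_mul_I]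

lemma latticeChar_add_intVec {n : ℕ} (k l : Fin n → ℤ) (x : Fin n → ℝ) :
    latticeChar k (x + intVec l) = latticeChar k x := by
  rw [← mFourier_coe_eq_latticeChar, ← mFourier_coe_eq_latticeChar]
  congr 1
  ext i
  simp [intVec]

/-- **Poisson summation** for a continuous function of rapid decay with summable
Fourier coefficients. -/
lemma hasSum_integral_latticeChar_mul {n : ℕ} (hn : 2 ≤ n) {f : (Fin n → ℝ) → ℂ}
    (hf : Continuous f) (hfi : Integrable f) {C : ℝ}
    (hC : ∀ x, ‖f x‖ ≤ C * (1 + ‖x‖) ^ (-(n + 1) : ℝ))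
    (hs : Summable fun k : Fin n → ℤ => ∫ x, latticeChar (-k) x * f x) (x : Fin n → ℝ) :
    HasSum (fun k : Fin n → ℤ => (∫ x, latticeChar (-k) x * f x) * latticeChar k x)
      (∑' l : Fin n → ℤ, f (x + intVec l)) := by
  have hq' : IsOpenQuotientMap fun (x : Fin n → ℝ) i => (x i : UnitAddCircle) :=
    IsOpenQuotientMap.piMap fun _ : Fin n => QuotientAddGroup.isOpenQuotientMap_mk
  let q : C(Fin n → ℝ, UnitAddTorus (Fin n)) := ⟨_, hq'.continuous⟩
  have hq : Topology.IsQuotientMap q := hq'.isQuotientMap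
  let G : C(Fin n → ℝ, ℂ) := ⟨_, continuous_tsum_translate_intVec hn hf hC⟩
  have hG : Function.FactorsThrough G q := by
    intro x y hxy
    have h : ∀ i, ∃ m : ℤ, x i = y i + m := fun i => by
      have h : ((y i : ℝ) : UnitAddCircle) = (x i : ℝ) := (congrFun hxy i).symm
      obtain ⟨m, hm⟩ := AddSubgroup.mem_zmultiples_iff.1 (QuotientAddGroup.eq.1 h)
      exact ⟨m, by simp at hm; linarith⟩
    choose m hm using h
    have hx : x = y + intVec m := by ext i; simp [hm, intVec]
    subst hx
    change ∑' l : Fin n → ℤ, f (y + intVec m + intVec l) = ∑' l : Fin n → ℤ, f (y + intVec l)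
    rw [← (Equiv.addLeft m).tsum_eq fun l => f (y + intVec l)]
    refine tsum_congr fun l => ?_
    congr 1
    ext i
    simp [intVec, add_assoc]
  let T : C(UnitAddTorus (Fin n), ℂ) := hq.lift G hG
  have hT : ∀ x, T (q x) = ∑' l : Fin n → ℤ, f (x + intVec l) := fun x =>
    congrArg (fun h : C(Fin n → ℝ, ℂ) => h x) (hq.lift_comp G hG)
  have hcoeff : ∀ k, UnitAddTorus.mFourierCoeff T k = ∫ x, latticeChar (-k) x * f x := by
    intro k
    have hint : Integrable fun x => latticeChar (-k) x * f x :=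
      hfi.bdd_mul (continuous_latticeChar _).aestronglyMeasurable
        (Eventually.of_forall fun x => (norm_latticeChar _ x).le)
    rw [UnitAddTorus.mFourierCoeff_eq_integral T k 0]
    have hset : {x : Fin n → ℝ | ∀ i, x i ∈ Set.Ioc ((0 : Fin n → ℝ) i) ((0 : Fin n → ℝ) i + 1)} =
        unitCube n := by simp [unitCube]
    rw [hset]
    have h1 := hasSum_integral_unitCube hint
    have hfin : IsFiniteMeasure (volume.restrict (unitCube n)) :=
      ⟨by rw [Measure.restrict_apply_univ, volume_unitCube]; simp⟩
    have h2 := hasSum_integral_of_summable_integral_norm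
      (F := fun (l : Fin n → ℤ) x => latticeChar (-k) x * f (x + intVec l))
      (μ := volume.restrict (unitCube n)) (fun l => by
        have := hint.comp_add_right (intVec l)
        simp only [latticeChar_add_intVec] at this
        exact this.integrableOn) (by
        have h3 := hasSum_integral_unitCube (n := n) (f := fun x => (‖f x‖ : ℂ)) hfi.norm.ofReal
        simp only [integral_complex_ofReal] at h3
        have h4 := Complex.hasSum_ofReal.1 h3
        simpa [norm_latticeChar] using h4.summable)
    simp only [latticeChar_add_intVec] at h1
    rw [h1.unique h2]
    refine integral_congr_ae (Eventually.of_forall fun x => ?_)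
    simp only [smul_eq_mul]
    rw [mFourier_coe_eq_latticeChar, tsum_mul_left]
    congr 1
    exact hT x
  have h := UnitAddTorus.hasSum_mFourier_series_apply_of_summable (f := T)
    (by rw [show UnitAddTorus.mFourierCoeff T = _ from funext hcoeff]; exact hs) (q x)
  simp only [hcoeff, hT, smul_eq_mul] at h
  simpa only [q, ContinuousMap.coe_mk, mFourier_coe_eq_latticeChar] using h

open FourierTransform in
/-- Poisson summation over the lattice `L ℤⁿ`, where `L` has Jacobian determinant `±D` and `ξ`
parametrizes the dual lattice. -/
lemma hasSum_fourier_dual_lattice {n : ℕ} (hn : 2 ≤ n)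
    (L : (Fin n → ℝ) ≃L[ℝ] EuclideanSpace ℝ (Fin n)) {D : ℝ}
    (hD : ∀ g : EuclideanSpace ℝ (Fin n) → ℂ, ∫ x, g (L x) = (D : ℂ)⁻¹ * ∫ y, g y)
    {ξ : (Fin n → ℤ) → EuclideanSpace ℝ (Fin n)}
    (hξ : ∀ k x, inner ℝ (L x) (ξ k) = ∑ i, k i * x i)
    {H : EuclideanSpace ℝ (Fin n) → ℂ} (hH : Continuous H) {C : ℝ}
    (hC : ∀ y, ‖H y‖ ≤ C * (1 + ‖y‖) ^ (-(n + 1) : ℝ))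
    (hs : Summable fun k => 𝓕 H (ξ k)) :
    HasSum (fun k => (D : ℂ)⁻¹ * 𝓕 H (ξ k)) (∑' l : Fin n → ℤ, H (L (intVec l))) := by
  have hC0 : 0 ≤ C := by simpa using (norm_nonneg _).trans (hC 0)
  set K : ℝ := max 1 ‖(L.symm : EuclideanSpace ℝ (Fin n) →L[ℝ] (Fin n → ℝ))‖
  have hK : 1 ≤ K := le_max_left _ _
  have hdecay : ∀ x, ‖H (L x)‖ ≤
      C * K ^ (n + 1 : ℝ) * (1 + ‖x‖) ^ (-(n + 1) : ℝ) := fun x => by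
    have h1 : ‖x‖ ≤ K * ‖L x‖ := by
      have h := (L.symm : EuclideanSpace ℝ (Fin n) →L[ℝ] (Fin n → ℝ)).le_opNorm (L x)
      simp only [ContinuousLinearEquiv.coe_coe, ContinuousLinearEquiv.symm_apply_apply] at h
      exact h.trans (by gcongr; exact le_max_right _ _)
    refine (hC _).trans ?_
    rw [mul_assoc]
    gcongr
    calc (1 + ‖L x‖) ^ (-(n + 1) : ℝ) ≤ ((1 + ‖x‖) / K) ^ (-(n + 1) : ℝ) := by
          refine Real.rpow_le_rpow_of_nonpos (by positivity) ?_ (by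
            have : (0 : ℝ) ≤ n := n.cast_nonneg
            linarith)
          rw [div_le_iff₀ (by positivity)]
          linarith
      _ = _ := by
          rw [Real.div_rpow (by positivity) (by positivity), Real.rpow_neg (by positivity : 0 ≤ K)]
          field_simp
  have hcoeff : ∀ k, ∫ x, latticeChar (-k) x * H (L x) = (D : ℂ)⁻¹ * 𝓕 H (ξ k) := fun k => by
    rw [Real.fourier_eq', ← hD]
    refine integral_congr_ae (Eventually.of_forall fun x => ?_)
    simp only [hξ, latticeChar, smul_eq_mul]
    congr 2
    push_cast
    simp only [Pi.neg_apply, Int.cast_neg, neg_mul, Finset.sum_neg_distrib]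
    ring
  have hHL : Continuous fun x => H (L x) := hH.comp L.continuous
  have hint : Integrable fun x => H (L x) := by
    refine ((integrable_one_add_norm (E := Fin n → ℝ) (μ := volume) (r := n + 1)
      (by simp)).const_mul (C * K ^ (n + 1 : ℝ))).mono' hHL.aestronglyMeasurable
      (Eventually.of_forall hdecay)
  have h := hasSum_integral_latticeChar_mul hn hHL hint hdecay
    (by simpa only [hcoeff] using hs.mul_left _) 0
  simp only [hcoeff] at h
  simpa [latticeChar] using h

lemma summable_and_norm_tsum_sub_le {ι : Type*} {c : ι → ℂ} (i₀ : ι) {T : ℝ}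
    (h : ∀ S : Finset ι, (∀ i ∈ S, i ≠ i₀) → ∑ i ∈ S, ‖c i‖ ≤ T) :
    Summable c ∧ ‖∑' i, c i - c i₀‖ ≤ T := by
  classical
  have hs : Summable c := by
    refine .of_norm (summable_of_sum_le (c := ‖c i₀‖ + T) (fun _ => norm_nonneg _) fun S => ?_)
    calc ∑ i ∈ S, ‖c i‖ ≤ ∑ i ∈ insert i₀ (S.erase i₀), ‖c i‖ :=
          Finset.sum_le_sum_of_subset_of_nonneg (fun i hi => by
            by_cases h : i = i₀ <;> simp [h, hi]) fun _ _ _ => norm_nonneg _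
      _ ≤ ‖c i₀‖ + T := by
          rw [Finset.sum_insert (Finset.notMem_erase _ _)]
          gcongr
          exact h _ fun i hi => Finset.ne_of_mem_erase hi
  refine ⟨hs, ?_⟩
  have hlim : Tendsto (fun S : Finset ι => ‖∑ i ∈ S, c i - c i₀‖) atTop
      (nhds ‖∑' i, c i - c i₀‖) := (hs.hasSum.sub_const _).norm
  refine le_of_tendsto hlim ((eventually_ge_atTop {i₀}).mono fun S hS => ?_)
  rw [← Finset.sum_erase_eq_sub (hS (Finset.mem_singleton_self i₀))]
  exact (norm_sum_le _ _).trans (h _ fun i hi => Finset.ne_of_mem_erase hi)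

open Convolution in
lemma norm_convolution_le_of_support {E : Type*} [NormedAddCommGroup E] [MeasurableSpace E]
    {μ : Measure E} {f g : E → ℂ} (hf : Integrable f μ) {R a C : ℝ}
    (ha : 0 ≤ a) (hR : ∀ t, R < ‖t‖ → f t = 0)
    (hC : ∀ x, ‖g x‖ ≤ C * (1 + ‖x‖) ^ (-a)) (x : E) :
    ‖(f ⋆[ContinuousLinearMap.mul ℂ ℂ, μ] g) x‖ ≤
      (∫ t, ‖f t‖ ∂μ) * (C * (1 + R) ^ a) * (1 + ‖x‖) ^ (-a) := by
  have hC0 : 0 ≤ C := by simpa using (norm_nonneg _).trans (hC 0)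
  rw [mul_assoc, ← integral_mul_const]
  refine norm_integral_le_of_norm_le (hf.norm.mul_const _) (Eventually.of_forall fun t => ?_)
  rw [ContinuousLinearMap.mul_apply', norm_mul]
  by_cases ht : ‖t‖ ≤ R
  · gcongr
    refine (hC _).trans ?_
    rw [mul_assoc]
    gcongr
    rw [sub_eq_neg_add]
    exact one_add_norm_add_rpow_le ha (-t) x (by rwa [norm_neg])
  · simp [hR t (not_le.1 ht)]

lemma exists_norm_le_one_add_rpow {E F : Type*} [NormedAddCommGroup E] [NormedSpace ℝ E]
    [NormedAddCommGroup F] [NormedSpace ℝ F] (f : SchwartzMap E F) (N : ℕ) :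
    ∃ C, 0 ≤ C ∧ ∀ x, ‖f x‖ ≤ C * (1 + ‖x‖) ^ (-N : ℝ) := by
  refine ⟨2 ^ N * ((Finset.Iic (N, 0)).sup fun m => SchwartzMap.seminorm ℝ m.1 m.2) f,
    by positivity, fun x => ?_⟩
  have h := SchwartzMap.one_add_le_sup_seminorm_apply (𝕜 := ℝ) (m := (N, 0)) le_rfl le_rfl f x
  rw [norm_iteratedFDeriv_zero] at h
  rw [Real.rpow_neg (by positivity), Real.rpow_natCast, ← div_eq_mul_inv, le_div_iff₀ (by positivity)]
  rwa [mul_comm]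

/-- A basis of `ℝⁿ` yields linear coordinates with Jacobian determinant that of the matrix of the
basis vectors. -/
lemma exists_continuousLinearEquiv_of_basis {n : ℕ} (v : Fin n → EuclideanSpace ℝ (Fin n))
    (hv : LinearIndependent ℝ v) (hspan : Submodule.span ℝ (Set.range v) = ⊤) :
    ∃ L : (Fin n → ℝ) ≃L[ℝ] EuclideanSpace ℝ (Fin n), (∀ x, L x = ∑ j, x j • v j) ∧
      ∀ g : EuclideanSpace ℝ (Fin n) → ℂ, ∫ x, g (L x) =
        ((|(Matrix.of fun i j => v j i).det| : ℝ) : ℂ)⁻¹ * ∫ y, g y := by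
  set b := Module.Basis.mk hv hspan.ge
  let L : (Fin n → ℝ) ≃L[ℝ] EuclideanSpace ℝ (Fin n) := b.equivFun.symm.toContinuousLinearEquiv
  have hL : ∀ x, L x = ∑ j, x j • v j := fun x => by
    simp [L, b, Module.Basis.equivFun_symm_apply]
  refine ⟨L, hL, fun g => ?_⟩
  set M : Matrix (Fin n) (Fin n) ℝ := Matrix.of fun i j => v j i
  let T : (Fin n → ℝ) ≃L[ℝ] (Fin n → ℝ) := L.trans (EuclideanSpace.equiv (Fin n) ℝ)
  have hT : ∀ x, T x = Matrix.toLin' M x := fun x => by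
    ext i
    simp [T, hL, M, Matrix.mulVec, dotProduct, mul_comm]
  have hTM : (T.toLinearEquiv : (Fin n → ℝ) →ₗ[ℝ] (Fin n → ℝ)) = Matrix.toLin' M :=
    LinearMap.ext hT
  have hM : M.det ≠ 0 := by
    have h := T.toLinearEquiv.isUnit_det'
    rw [hTM, LinearMap.det_toLin'] at h
    exact h.ne_zero
  have hmap := Real.map_matrix_volume_pi_eq_smul_volume_pi hM
  have h1 : ∫ x, g (L x) = ∫ x, g (WithLp.toLp 2 x) ∂(Measure.map (Matrix.toLin' M) volume) := by
    rw [← (funext hT : ⇑T = Matrix.toLin' M)]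
    exact (T.toHomeomorph.measurableEmbedding.integral_map (μ := volume)
      fun x => g (WithLp.toLp 2 x)).symm
  rw [h1, hmap, integral_smul_measure, (PiLp.volume_preserving_toLp (Fin n)).integral_comp
    (MeasurableEquiv.toLp 2 (Fin n → ℝ)).measurableEmbedding g,
    ENNReal.toReal_ofReal (abs_nonneg _), Complex.real_smul, abs_inv, Complex.ofReal_inv]

lemma exists_dual_lattice {n : ℕ} (L : (Fin n → ℝ) ≃L[ℝ] EuclideanSpace ℝ (Fin n)) :
    ∃ ξ : (Fin n → ℤ) → EuclideanSpace ℝ (Fin n), (∀ k x, inner ℝ (L x) (ξ k) = ∑ i, k i * x i) ∧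
      ξ 0 = 0 ∧ ∃ K, 1 ≤ K ∧ ∀ k, ‖intVec k‖ ≤ K * ‖ξ k‖ := by
  have hex : ∀ k : Fin n → ℤ, ∃ w : EuclideanSpace ℝ (Fin n),
      ∀ x, inner ℝ (L x) w = ∑ i, k i * x i := fun k => by
    let φ : (Fin n → ℝ) →L[ℝ] ℝ := ∑ i, (k i : ℝ) • ContinuousLinearMap.proj i
    refine ⟨(InnerProductSpace.toDual ℝ _).symm
      (φ.comp (L.symm : EuclideanSpace ℝ (Fin n) →L[ℝ] (Fin n → ℝ))), fun x => ?_⟩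
    rw [real_inner_comm, InnerProductSpace.toDual_symm_apply]
    simp [φ]
  choose ξ hξ using hex
  refine ⟨ξ, hξ, ?_, 1 + ∑ i, ‖L (Pi.single i 1)‖,
    le_add_of_nonneg_right (by positivity), fun k => ?_⟩
  · have h := hξ 0 (L.symm (ξ 0))
    simpa using h
  · rw [pi_norm_le_iff_of_nonneg (by positivity)]
    intro i
    have h := hξ k (Pi.single i 1)
    rw [Finset.sum_eq_single i (fun j _ hj => by simp [hj]) (by simp)] at h
    simp only [Pi.single_eq_same, mul_one] at h
    rw [intVec, ← h]
    refine (norm_inner_le_norm _ _).trans ?_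
    gcongr
    have := Finset.single_le_sum (f := fun i => ‖L (Pi.single i 1)‖) (fun i _ => norm_nonneg _)
      (Finset.mem_univ i)
    linarith

open FourierTransform in
lemma fourier_dilation {n : ℕ} (ρ : EuclideanSpace ℝ (Fin n) → ℂ) {ε : ℝ} (hε : 0 < ε)
    (ξ : EuclideanSpace ℝ (Fin n)) :
    𝓕 (fun x => ((ε : ℂ) ^ n)⁻¹ * ρ (ε⁻¹ • x)) ξ = 𝓕 ρ (ε • ξ) := by
  rw [Real.fourier_eq', Real.fourier_eq']
  have h := Measure.integral_comp_inv_smul_of_nonneg volume (fun v : EuclideanSpace ℝ (Fin n) =>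
    Complex.exp (↑(-2 * Real.pi * inner ℝ v (ε • ξ)) * Complex.I) • ρ v) hε.le
  simp only [finrank_euclideanSpace, Fintype.card_fin, inner_smul_left, inner_smul_right,
    Complex.real_smul, smul_eq_mul, conj_trivial] at h
  have hne : (ε : ℂ) ^ n ≠ 0 := pow_ne_zero _ (by exact_mod_cast hε.ne')
  have h2 : ∫ v : EuclideanSpace ℝ (Fin n), Complex.exp (↑(-2 * Real.pi * inner ℝ v ξ) * Complex.I) •
      (((ε : ℂ) ^ n)⁻¹ * ρ (ε⁻¹ • v)) = ((ε : ℂ) ^ n)⁻¹ *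
      ∫ v : EuclideanSpace ℝ (Fin n), Complex.exp (↑(-2 * Real.pi * inner ℝ v ξ) * Complex.I) *
        ρ (ε⁻¹ • v) := by
    rw [← integral_const_mul]
    refine integral_congr_ae (Eventually.of_forall fun x => ?_)
    simp only [smul_eq_mul]
    ring
  rw [h2]
  simp only [inner_smul_right, smul_eq_mul]
  simp only [mul_inv_cancel_left₀ hε.ne', Complex.ofReal_pow] at h
  rw [h, inv_mul_cancel_left₀ hne]

/-- The polynomial `P` cut off to the ball of radius `R`. -/
noncomputable def truncatedPoly {n : ℕ} (P : MvPolynomial (Fin n) ℝ) (R : ℝ)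
    (x : EuclideanSpace ℝ (Fin n)) : ℂ :=
  ((if ‖x‖ ≤ R then MvPolynomial.eval (fun i => x i) P else 0 : ℝ) : ℂ)

lemma integrable_truncatedPoly {n : ℕ} (P : MvPolynomial (Fin n) ℝ) (R : ℝ) :
    Integrable (truncatedPoly P R) := by
  have h : truncatedPoly P R = (Metric.closedBall (0 : EuclideanSpace ℝ (Fin n)) R).indicator
      fun x => ((MvPolynomial.eval (fun i => x i) P : ℝ) : ℂ) := by
    ext x
    by_cases hx : ‖x‖ ≤ R <;> simp [truncatedPoly, hx]
  rw [h, integrable_indicator_iff Metric.isClosed_closedBall.measurableSet]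
  exact (Complex.continuous_ofReal.comp (continuous_eval_euclidean P)).continuousOn.integrableOn_compact
    (isCompact_closedBall 0 R)

open FourierTransform in
lemma fourier_truncatedPoly {n d : ℕ} {P : MvPolynomial (Fin n) ℝ} (hP : P.IsHomogeneous d)
    {R : ℝ} (hR : 0 < R) (ξ : EuclideanSpace ℝ (Fin n)) :
    𝓕 (truncatedPoly P R) ξ =
      (R : ℂ) ^ (d + n) * ∫ x in Metric.closedBall (0 : EuclideanSpace ℝ (Fin n)) 1,
        Complex.exp (-(2 * Real.pi * Complex.I * (inner ℝ x (R • ξ) : ℝ))) *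
          ((MvPolynomial.eval (fun i => x i) P : ℝ) : ℂ) := by
  simp only [Real.fourier_eq', truncatedPoly]
  have h := Measure.integral_comp_smul_of_nonneg volume (fun v : EuclideanSpace ℝ (Fin n) =>
    Complex.exp (↑(-2 * Real.pi * inner ℝ v ξ) * Complex.I) •
      ((if ‖v‖ ≤ R then MvPolynomial.eval (fun i => v i) P else 0 : ℝ) : ℂ)) R (hR := hR.le)
  have hne : (R : ℂ) ^ n ≠ 0 := pow_ne_zero _ (by exact_mod_cast hR.ne')
  simp only [finrank_euclideanSpace, Fintype.card_fin, Complex.real_smul, Complex.ofReal_inv,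
    Complex.ofReal_pow] at h
  rw [← mul_right_inj' (inv_ne_zero hne), ← h, pow_add, mul_comm ((R : ℂ) ^ d), mul_assoc,
    inv_mul_cancel_left₀ hne, ← integral_const_mul,
    ← integral_indicator Metric.isClosed_closedBall.measurableSet]
  refine integral_congr_ae (Eventually.of_forall fun x => ?_)
  have hscale : MvPolynomial.eval (fun i => (R • x) i) P =
      R ^ d * MvPolynomial.eval (fun i => x i) P := by
    rw [MvPolynomial.eval_eq', MvPolynomial.eval_eq', Finset.mul_sum]
    refine Finset.sum_congr rfl fun m hm => ?_
    have hm' : m.degree = d := by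
      by_contra h
      exact MvPolynomial.mem_support_iff.1 hm (hP.coeff_eq_zero h)
    simp only [PiLp.smul_apply, smul_eq_mul, mul_pow, Finset.prod_mul_distrib]
    rw [Finset.prod_pow_eq_pow_sum, ← Finsupp.degree_eq_sum, hm']
    ring
  by_cases hx : ‖x‖ ≤ 1
  · have hx' : ‖R • x‖ ≤ R := by
      rw [norm_smul, Real.norm_of_nonneg hR.le]; nlinarith
    simp only
    rw [Set.indicator_of_mem (by simpa using hx), if_pos hx', hscale, inner_smul_left,
      inner_smul_right, smul_eq_mul]
    push_cast
    simp only [conj_trivial]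
    rw [mul_left_comm]
    congr 3
    ring
  · have hx' : ¬ ‖R • x‖ ≤ R := by
      rw [norm_smul, Real.norm_of_nonneg hR.le]; nlinarith
    simp only
    rw [Set.indicator_of_notMem (by simpa using hx), if_neg hx']
    simp

open FourierTransform in
lemma exists_sum_norm_fourier_mul_le {n d : ℕ} (hn : 2 ≤ n) {P : MvPolynomial (Fin n) ℝ}
    (hP : P.IsHomogeneous d) (φ : SchwartzMap (EuclideanSpace ℝ (Fin n)) ℂ)
    {ξ : (Fin n → ℤ) → EuclideanSpace ℝ (Fin n)} {K : ℝ} (hK : 1 ≤ K)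
    (hξ : ∀ k, ‖intVec k‖ ≤ K * ‖ξ k‖) :
    ∃ C, 0 ≤ C ∧ ∀ R, K ≤ R → ∀ ε, 0 < ε → ∀ S : Finset (Fin n → ℤ), (∀ k ∈ S, k ≠ 0) →
      ∑ k ∈ S, ‖𝓕 (truncatedPoly P R) (ξ k)‖ * ‖𝓕 φ (ε • ξ k)‖ ≤
        C * R ^ ((d : ℝ) + ((n : ℝ) - 1) / 2) * ε ^ (-(((n : ℝ) - 1) / 2)) := by
  obtain ⟨C₁, hC₁, h₁⟩ := exists_norm_fourier_closedBall_le hn P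
  obtain ⟨C₂, hC₂, h₂⟩ := exists_norm_le_one_add_rpow (𝓕 φ) n
  have hn' : (2 : ℝ) ≤ n := by exact_mod_cast hn
  set s : ℝ := (n + 1 : ℝ) / 2 with hs
  obtain ⟨C₃, hC₃, h₃⟩ := exists_sum_norm_rpow_mul_le (n := n) (s := s) (by omega)
    (by positivity) (by linarith)
  have hK0 : 0 < K := by linarith
  refine ⟨C₁ * K ^ s * (C₂ * K ^ (n : ℝ)) * C₃, by positivity, fun R hR ε hε S hS => ?_⟩
  have hR0 : 0 < R := by linarith
  have hRpow : R ^ (d + n) * R ^ (-s) = R ^ ((d : ℝ) + ((n : ℝ) - 1) / 2) := by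
    rw [← Real.rpow_natCast, ← Real.rpow_add hR0]
    congr 1
    push_cast
    rw [hs]; ring
  have hterm : ∀ k ∈ S, ‖𝓕 (truncatedPoly P R) (ξ k)‖ * ‖𝓕 φ (ε • ξ k)‖ ≤
      C₁ * K ^ s * (C₂ * K ^ (n : ℝ)) * R ^ ((d : ℝ) + ((n : ℝ) - 1) / 2) *
        (‖intVec k‖ ^ (-s) * (1 + ε * ‖intVec k‖) ^ (-n : ℝ)) := fun k hk => by
    have hk1 : 1 ≤ ‖intVec k‖ := one_le_norm_intVec (hS k hk)
    have hlow : ‖intVec k‖ / K ≤ ‖ξ k‖ := by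
      rw [div_le_iff₀' hK0]; exact hξ k
    have hfar : 1 ≤ ‖R • ξ k‖ := by
      rw [norm_smul, Real.norm_of_nonneg hR0.le]
      exact hk1.trans ((hξ k).trans (by gcongr))
    have hF : ‖𝓕 (truncatedPoly P R) (ξ k)‖ ≤
        C₁ * K ^ s * R ^ ((d : ℝ) + ((n : ℝ) - 1) / 2) * ‖intVec k‖ ^ (-s) := by
      rw [fourier_truncatedPoly hP hR0, norm_mul, norm_pow, Complex.norm_real,
        Real.norm_of_nonneg hR0.le]
      calc _ ≤ R ^ (d + n) * (C₁ * ‖R • ξ k‖ ^ (-s)) := by gcongr; exact h₁ _ hfar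
        _ = C₁ * R ^ ((d : ℝ) + ((n : ℝ) - 1) / 2) * ‖ξ k‖ ^ (-s) := by
          rw [norm_smul, Real.norm_of_nonneg hR0.le, Real.mul_rpow hR0.le (norm_nonneg _), ← hRpow]
          ring
        _ ≤ C₁ * R ^ ((d : ℝ) + ((n : ℝ) - 1) / 2) * (‖intVec k‖ / K) ^ (-s) := by
          have := Real.rpow_le_rpow_of_nonpos (z := -s) (by positivity) hlow
            (neg_nonpos.2 (by positivity))
          gcongr
        _ = _ := by
          rw [Real.div_rpow (by positivity) hK0.le, Real.rpow_neg hK0.le, div_inv_eq_mul]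
          ring
    have hφ : ‖𝓕 φ (ε • ξ k)‖ ≤ C₂ * K ^ (n : ℝ) * (1 + ε * ‖intVec k‖) ^ (-n : ℝ) := by
      refine (h₂ _).trans ?_
      rw [norm_smul, Real.norm_of_nonneg hε.le, mul_assoc]
      gcongr
      calc (1 + ε * ‖ξ k‖) ^ (-n : ℝ) ≤ ((1 + ε * ‖intVec k‖) / K) ^ (-n : ℝ) := by
            refine Real.rpow_le_rpow_of_nonpos (by positivity) ?_ (by linarith)
            rw [div_le_iff₀ hK0]
            nlinarith [mul_le_mul_of_nonneg_left (hξ k) hε.le]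
        _ = _ := by
            rw [Real.div_rpow (by positivity) hK0.le, Real.rpow_neg hK0.le, div_inv_eq_mul,
              mul_comm]
    calc _ ≤ (C₁ * K ^ s * R ^ ((d : ℝ) + ((n : ℝ) - 1) / 2) * ‖intVec k‖ ^ (-s)) *
          (C₂ * K ^ (n : ℝ) * (1 + ε * ‖intVec k‖) ^ (-n : ℝ)) := by gcongr
      _ = _ := by ring
  refine (Finset.sum_le_sum hterm).trans ?_
  rw [← Finset.mul_sum]
  calc _ ≤ C₁ * K ^ s * (C₂ * K ^ (n : ℝ)) * R ^ ((d : ℝ) + ((n : ℝ) - 1) / 2) *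
        (C₃ * ε ^ (s - n)) := by gcongr; exact h₃ ε hε S hS
    _ = _ := by
        rw [show s - n = -(((n : ℝ) - 1) / 2) by rw [hs]; ring]
        ring

open FourierTransform Convolution in
lemma exists_norm_tsum_convolution_sub_le {n d : ℕ} (hn : 2 ≤ n) {P : MvPolynomial (Fin n) ℝ}
    (hP : P.IsHomogeneous d) (φ : SchwartzMap (EuclideanSpace ℝ (Fin n)) ℂ)
    (L : (Fin n → ℝ) ≃L[ℝ] EuclideanSpace ℝ (Fin n)) {D : ℝ}
    (hD : ∀ g : EuclideanSpace ℝ (Fin n) → ℂ, ∫ x, g (L x) = (D : ℂ)⁻¹ * ∫ y, g y) :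
    ∃ C, 0 ≤ C ∧ ∃ R₀, 1 ≤ R₀ ∧ ∀ R, R₀ ≤ R → ∀ ε : ℝ, 0 < ε → ε ≤ 1 →
      ‖(∑' l : Fin n → ℤ, (truncatedPoly P R ⋆[ContinuousLinearMap.mul ℂ ℂ]
          fun x => ((ε : ℂ) ^ n)⁻¹ * φ (ε⁻¹ • x)) (L (intVec l))) -
        (D : ℂ)⁻¹ * (𝓕 (truncatedPoly P R) 0 * ∫ x, φ x)‖ ≤
      C * R ^ ((d : ℝ) + ((n : ℝ) - 1) / 2) * ε ^ (-(((n : ℝ) - 1) / 2)) := by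
  obtain ⟨ξ, hξ, hξ0, K, hK, hKξ⟩ := exists_dual_lattice L
  obtain ⟨C, hC, hsum⟩ := exists_sum_norm_fourier_mul_le hn hP φ hK hKξ
  obtain ⟨C₁, hC₁, hφ⟩ := exists_norm_le_one_add_rpow φ (n + 1)
  refine ⟨|D|⁻¹ * C, by positivity, K, hK, fun R hR ε hε hε1 => ?_⟩
  set σ : EuclideanSpace ℝ (Fin n) → ℂ := fun x => ((ε : ℂ) ^ n)⁻¹ * φ (ε⁻¹ • x)
  set H := truncatedPoly P R ⋆[ContinuousLinearMap.mul ℂ ℂ] σ with hHdef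
  have hσc : Continuous σ := by fun_prop
  have hσi : Integrable σ := (φ.integrable.comp_smul (inv_ne_zero hε.ne')).const_mul _
  have hF := integrable_truncatedPoly P R
  have hcn : (0 : ℝ) ≤ n + 1 := by positivity
  have hσ : ∀ x, ‖σ x‖ ≤ (ε ^ n)⁻¹ * C₁ * (1 + ‖x‖) ^ (-(n + 1) : ℝ) := fun x => by
    rw [norm_mul, norm_inv, norm_pow, Complex.norm_real, Real.norm_of_nonneg hε.le, mul_assoc]
    gcongr
    refine (hφ _).trans ?_
    push_cast
    gcongr ?_ * ?_
    refine Real.rpow_le_rpow_of_nonpos (by positivity) ?_ (by linarith)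
    rw [norm_smul, norm_inv, Real.norm_of_nonneg hε.le]
    gcongr
    exact le_mul_of_one_le_left (norm_nonneg _) ((one_le_inv₀ hε).2 hε1)
  have hHc : Continuous H := by
    refine BddAbove.continuous_convolution_right_of_integrable _ ?_ hF hσc
    refine ⟨(ε ^ n)⁻¹ * C₁, ?_⟩
    rintro _ ⟨x, rfl⟩
    refine (hσ x).trans (mul_le_of_le_one_right (by positivity) ?_)
    exact Real.rpow_le_one_of_one_le_of_nonpos (by linarith [norm_nonneg x]) (by linarith)
  have hFH : ∀ k, 𝓕 H (ξ k) = 𝓕 (truncatedPoly P R) (ξ k) * 𝓕 φ (ε • ξ k) := fun k => by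
    rw [hHdef, Real.fourier_mul_convolution_eq hF hσi, fourier_dilation _ hε, SchwartzMap.fourier_coe]
  have hT := summable_and_norm_tsum_sub_le (c := fun k => 𝓕 H (ξ k)) 0
    (fun S hS => by simpa only [hFH, norm_mul] using hsum R hR ε hε S hS)
  have hpoisson := hasSum_fourier_dual_lattice hn L hD hξ hHc
    (norm_convolution_le_of_support hF hcn (R := R)
      (fun t ht => by simp [truncatedPoly, not_le.2 ht]) hσ) hT.1
  have h0 : 𝓕 φ 0 = ∫ x, φ x := by
    simp [SchwartzMap.fourier_coe, Real.fourier_eq']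
  have hzero : 𝓕 H (ξ 0) = 𝓕 (truncatedPoly P R) 0 * ∫ x, φ x := by
    rw [hFH, hξ0, smul_zero, h0]
  rw [← hpoisson.tsum_eq, tsum_mul_left, ← hzero, ← mul_sub, norm_mul, norm_inv,
    Complex.norm_real, Real.norm_eq_abs, mul_assoc |D|⁻¹, mul_assoc |D|⁻¹]
  gcongr
  exact hT.2

/-- **Asymptotics of the mollified weighted lattice sum.**
Let `F` be a homogeneous polynomial of degree `d ≥ 1` on `ℝⁿ` (`n ≥ 2`), `Γ` the full-rank
lattice generated by a basis `v₁, …, vₙ`, `ρ` a Schwartz function of total integral one,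
`ρ_ε(x) = ε⁻ⁿ ρ(x/ε)`, `F_R = F·1_{|x|≤R}` and `𝓜_ε(R) = Σ_{λ∈Γ} (F_R ⋆ ρ_ε)(λ)`.
Then there are `C > 0` and `R₀ > 0` such that for all `R ≥ R₀` and `ε ∈ (0,1]`,
`|𝓜_ε(R) − Vol(Γ*) R^{d+n} ∫_{|x|≤1} F| ≤ C R^{d+(n−1)/2} ε^{−(n−1)/2}`. -/
theorem stmt3 (n d : ℕ) (hn : 2 ≤ n) (hd : 1 ≤ d)
    (P : MvPolynomial (Fin n) ℝ) (hP : P.IsHomogeneous d)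
    (v : Fin n → EuclideanSpace ℝ (Fin n))
    (hv : LinearIndependent ℝ v) (hspan : Submodule.span ℝ (Set.range v) = ⊤)
    (ρ : SchwartzMap (EuclideanSpace ℝ (Fin n)) ℝ)
    (hρ : ∫ x, ρ x = 1)
    (FR : ℝ → EuclideanSpace ℝ (Fin n) → ℝ)
    (hFR : ∀ R x, FR R x = if ‖x‖ ≤ R then MvPolynomial.eval (fun i => x i) P else 0)
    (𝓜ε : ℝ → ℝ → ℝ)
    (h𝓜 : ∀ ε R, 𝓜ε ε R = ∑' ℓ : Fin n → ℤ,
      ∫ x, FR R ((∑ j, (ℓ j : ℝ) • v j) - x) * ((ε ^ n)⁻¹ * ρ (ε⁻¹ • x))) :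
    ∃ C > (0 : ℝ), ∃ R₀ > (0 : ℝ), ∀ R ≥ R₀, ∀ ε : ℝ, 0 < ε → ε ≤ 1 →
      |𝓜ε ε R -
          (1 / |(Matrix.of fun i j => v j i).det|) * R ^ (d + n) *
            ∫ x in Metric.closedBall (0 : EuclideanSpace ℝ (Fin n)) 1,
              MvPolynomial.eval (fun i => x i) P|
        ≤ C * R ^ ((d : ℝ) + ((n : ℝ) - 1) / 2) * ε ^ (-(((n : ℝ) - 1) / 2)) := by
  obtain ⟨L, hL, hD⟩ := exists_continuousLinearEquiv_of_basis v hv hspan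
  set D : ℝ := |(Matrix.of fun i j => v j i).det|
  let φ : SchwartzMap (EuclideanSpace ℝ (Fin n)) ℂ := ρ.postcompCLM Complex.ofRealCLM
  have hφ : ∀ x, φ x = (ρ x : ℂ) := fun x => rfl
  obtain ⟨C, hC, R₀, hR₀, hbound⟩ := exists_norm_tsum_convolution_sub_le hn hP φ L hD
  refine ⟨C + 1, by positivity, R₀, by positivity, fun R hR ε hε hε1 => ?_⟩
  have hR0 : 0 < R := by linarith
  have hM : ((𝓜ε ε R : ℝ) : ℂ) = ∑' l : Fin n → ℤ,
      convolution (truncatedPoly P R) (fun x => ((ε : ℂ) ^ n)⁻¹ * φ (ε⁻¹ • x))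
        (ContinuousLinearMap.mul ℂ ℂ) volume (L (intVec l)) := by
    rw [h𝓜, Complex.ofReal_tsum]
    refine tsum_congr fun l => ?_
    rw [convolution_eq_swap, ← integral_complex_ofReal]
    refine integral_congr_ae (Eventually.of_forall fun x => ?_)
    simp only [ContinuousLinearMap.mul_apply', hφ, truncatedPoly, hFR, hL, intVec]
    push_cast
    rfl
  have hmain : (D : ℂ)⁻¹ * (FourierTransform.fourier (truncatedPoly P R) 0 * ∫ x, φ x) =
      (((1 / D) * R ^ (d + n) * ∫ x in Metric.closedBall (0 : EuclideanSpace ℝ (Fin n)) 1,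
        MvPolynomial.eval (fun i => x i) P : ℝ) : ℂ) := by
    have h1 : ∫ x, φ x = 1 := by simp only [hφ]; rw [integral_complex_ofReal, hρ, Complex.ofReal_one]
    rw [h1, fourier_truncatedPoly hP hR0]
    push_cast
    rw [← integral_complex_ofReal]
    simp [mul_assoc]
  have h := hbound R hR ε hε hε1
  rw [← hM, hmain, ← Complex.ofReal_sub, Complex.norm_real, Real.norm_eq_abs] at h
  refine h.trans ?_
  gcongr
  linarith
end
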